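/- Let N = 3 and let p, q, a, b ≥ 0 with pq > 1. Assume (p, q) lies under the critical Sobolev hyperbola, i.e. (N+a)/(p+1) + (N+b)/(q+1) > N−2. Then the Hénon–Lane–Emden system −Δu = |x|^a v^p, −Δv = |x|^b u^q on ℝ^N has no positive bounded solution: there is no pair (u, v) of bounded positive C² functions on ℝ^3 solving the system. -/

import Mathlib

open MeasureTheory Real

/-- The Laplacian of a function on Euclidean space, as the sum of its second
partial derivatives in the coordinate directions. -/
noncomputable def lap {N : ℕ} (f : EuclideanSpace ℝ (Fin N) → ℝ)
    (x : EuclideanSpace ℝ (Fin N)) : ℝ :=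
  ∑ i : Fin N,
    fderiv ℝ (fun y => fderiv ℝ f y (EuclideanSpace.single i 1)) x (EuclideanSpace.single i 1)

namespace HLE

open Filter Topology

/-- The space `ℝ³`. -/
abbrev E3 : Type := EuclideanSpace ℝ (Fin 3)

/-! ### The regularised Newtonian kernel -/

/-- Profile: `s^{-1/2}` for `s > 1`, its second Taylor polynomial at `1` for `s ≤ 1`. -/
noncomputable def gk (s : ℝ) : ℝ :=
  if s ≤ 1 then 15 / 8 - 5 / 4 * s + 3 / 8 * s ^ 2 else (√s)⁻¹

noncomputable def gk1 (s : ℝ) : ℝ :=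
  if s ≤ 1 then -(5 / 4) + 3 / 4 * s else -(1 / 2) * (s * √s)⁻¹

noncomputable def gk2 (s : ℝ) : ℝ :=
  if s ≤ 1 then 3 / 4 else 3 / 4 * (s ^ 2 * √s)⁻¹

lemma hasDerivAt_ite {f g : ℝ → ℝ} {f' g' : ℝ → ℝ}
    (hf : ∀ s, HasDerivAt f (f' s) s) (hg : ∀ s, 0 < s → HasDerivAt g (g' s) s)
    (h1 : f 1 = g 1) (h2 : f' 1 = g' 1) (s : ℝ) :
    HasDerivAt (fun s => if s ≤ 1 then f s else g s) (if s ≤ 1 then f' s else g' s) s := by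
  rcases lt_trichotomy s 1 with h | h | h
  · rw [if_pos h.le]
    refine (hf s).congr_of_eventuallyEq ?_
    filter_upwards [Iio_mem_nhds h] with t ht
    rw [if_pos (le_of_lt ht)]
  · subst h
    rw [if_pos le_rfl]
    have a1 : HasDerivWithinAt (fun s => if s ≤ 1 then f s else g s) (f' 1) (Set.Iic 1) 1 := by
      refine (hf 1).hasDerivWithinAt.congr ?_ ?_
      · intro t ht; exact if_pos ht
      · exact if_pos le_rfl
    have a2 : HasDerivWithinAt (fun s => if s ≤ 1 then f s else g s) (f' 1) (Set.Ici 1) 1 := by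
      rw [h2]
      refine (hg 1 one_pos).hasDerivWithinAt.congr ?_ ?_
      · intro t ht
        rcases eq_or_lt_of_le (show (1:ℝ) ≤ t from ht) with h | h
        · subst h; simp [h1]
        · exact if_neg (not_le.2 h)
      · simp [h1]
    have := a1.union a2
    rwa [Set.Iic_union_Ici, hasDerivWithinAt_univ] at this
  · rw [if_neg (not_le.2 h)]
    refine (hg s (by linarith)).congr_of_eventuallyEq ?_
    filter_upwards [Ioi_mem_nhds h] with t ht
    rw [if_neg (not_le.2 ht)]

lemma hasDerivAt_gk (s : ℝ) : HasDerivAt gk (gk1 s) s := by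
  unfold gk gk1
  refine hasDerivAt_ite (f := fun s => 15 / 8 - 5 / 4 * s + 3 / 8 * s ^ 2)
    (g := fun s => (√s)⁻¹) (f' := fun s => -(5 / 4) + 3 / 4 * s)
    (g' := fun s => -(1 / 2) * (s * √s)⁻¹) ?_ ?_ ?_ ?_ s
  · intro s
    have := (((hasDerivAt_id s).const_mul (5/4)).const_sub (15/8)).add
      (((hasDerivAt_id s).pow 2).const_mul (3/8))
    refine (this.congr_deriv ?_)
    simp; ring
  · intro s hs
    have h0 : √s ≠ 0 := (Real.sqrt_pos.2 hs).ne'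
    have := (Real.hasDerivAt_sqrt hs.ne').inv h0
    refine this.congr_deriv ?_
    have : √s ^ 2 = s := Real.sq_sqrt hs.le
    rw [this]
    field_simp
  · norm_num
  · norm_num

lemma hasDerivAt_gk1 (s : ℝ) : HasDerivAt gk1 (gk2 s) s := by
  unfold gk1 gk2
  refine hasDerivAt_ite (f := fun s => -(5 / 4) + 3 / 4 * s)
    (g := fun s => -(1 / 2) * (s * √s)⁻¹) (f' := fun s => 3 / 4)
    (g' := fun s => 3 / 4 * (s ^ 2 * √s)⁻¹) ?_ ?_ ?_ ?_ s
  · intro s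
    have := ((hasDerivAt_id s).const_mul (3/4)).const_add (-(5/4))
    refine (this.congr_deriv ?_)
    simp
  · intro s hs
    have h0 : √s ≠ 0 := (Real.sqrt_pos.2 hs).ne'
    have := (((hasDerivAt_id s).mul (Real.hasDerivAt_sqrt hs.ne')).inv
      (mul_ne_zero hs.ne' h0)).const_mul (-(1/2))
    refine this.congr_deriv ?_
    have h2 : √s ^ 2 = s := Real.sq_sqrt hs.le
    simp only [id, Pi.mul_apply]
    rw [mul_pow, h2]
    field_simp
    rw [h2]; ring
  · norm_num
  · norm_num

lemma continuous_gk2 : Continuous gk2 := by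
  have : gk2 = fun s => 3 / 4 * ((max s 1) ^ 2 * √(max s 1))⁻¹ := by
    funext s
    unfold gk2
    split_ifs with h
    · rw [max_eq_right h]; simp
    · rw [max_eq_left (not_le.1 h).le]
  rw [this]
  refine continuous_const.mul (Continuous.inv₀ (by fun_prop) ?_)
  intro s
  have : 0 < max s 1 := lt_max_of_lt_right one_pos
  positivity

lemma contDiff_gk1 : ContDiff ℝ 1 gk1 := by
  rw [contDiff_one_iff_deriv]
  refine ⟨fun s => (hasDerivAt_gk1 s).differentiableAt, ?_⟩
  have : deriv gk1 = gk2 := funext fun s => (hasDerivAt_gk1 s).deriv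
  rw [this]; exact continuous_gk2

lemma contDiff_gk : ContDiff ℝ 2 gk := by
  have : (2 : WithTop ℕ∞) = 1 + 1 := by norm_num
  rw [this, contDiff_succ_iff_deriv]
  refine ⟨fun s => (hasDerivAt_gk s).differentiableAt, ?_, ?_⟩
  · intro h; simp at h
  have : deriv gk = gk1 := funext fun s => (hasDerivAt_gk s).deriv
  rw [this]; exact contDiff_gk1

lemma gk_lap (s : ℝ) : 4 * s * gk2 s + 6 * gk1 s = -(15 / 2 * max 0 (1 - s)) := by
  unfold gk1 gk2
  split_ifs with h
  · rw [max_eq_right (by linarith)]; ring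
  · push Not at h
    rw [max_eq_left (by linarith)]
    have hs : 0 < s := by linarith
    have h0 : √s ≠ 0 := (Real.sqrt_pos.2 hs).ne'
    field_simp
    ring

/-- Regularised kernel at scale `ε`. -/
noncomputable def G (ε : ℝ) (z : E3) : ℝ := ε⁻¹ * gk (‖z‖ ^ 2 / ε ^ 2)

/-- `∇ G ε z = - κ ε z • z`. -/
noncomputable def kap (ε : ℝ) (z : E3) : ℝ := -(2 * ε⁻¹ ^ 3 * gk1 (‖z‖ ^ 2 / ε ^ 2))

/-- `- Δ G ε`. -/
noncomputable def rho (ε : ℝ) (z : E3) : ℝ := 15 / 2 * ε⁻¹ ^ 3 * max 0 (1 - ‖z‖ ^ 2 / ε ^ 2)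

lemma hasFDerivAt_scal (ε : ℝ) (z : E3) :
    HasFDerivAt (fun z : E3 => ‖z‖ ^ 2 / ε ^ 2) ((2 / ε ^ 2) • innerSL ℝ z) z := by
  have := (hasStrictFDerivAt_norm_sq z).hasFDerivAt.mul_const ((ε ^ 2)⁻¹)
  refine (this.congr_fderiv ?_)
  ext w
  simp
  ring

lemma hasFDerivAt_G {ε : ℝ} (z : E3) :
    HasFDerivAt (G ε) ((-kap ε z) • innerSL ℝ z) z := by
  have := ((hasDerivAt_gk (‖z‖ ^ 2 / ε ^ 2)).comp_hasFDerivAt z (hasFDerivAt_scal ε z)).const_mul ε⁻¹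
  refine (this.congr_fderiv ?_)
  ext w
  simp [kap]
  ring

lemma contDiff_G (ε : ℝ) : ContDiff ℝ 2 (G ε) := by
  unfold G
  exact contDiff_const.mul (contDiff_gk.comp ((contDiff_norm_sq ℝ).div_const _))

lemma continuous_G (ε : ℝ) : Continuous (G ε) := (contDiff_G ε).continuous

lemma contDiff_kap (ε : ℝ) : ContDiff ℝ 1 (kap ε) := by
  unfold kap
  exact (contDiff_const.mul (contDiff_gk1.comp ((contDiff_norm_sq ℝ).div_const _))).neg

lemma continuous_kap (ε : ℝ) : Continuous (kap ε) := (contDiff_kap ε).continuous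

lemma continuous_rho (ε : ℝ) : Continuous (rho ε) := by
  unfold rho; fun_prop

lemma lap_G {ε : ℝ} (hε : 0 < ε) (z : E3) : lap (G ε) z = -rho ε z := by
  unfold lap
  have h1 : ∀ i : Fin 3, (fun y => fderiv ℝ (G ε) y (EuclideanSpace.single i 1)) =
      fun y : E3 => 2 * ε⁻¹ ^ 3 * (gk1 (‖y‖ ^ 2 / ε ^ 2) * y i) := by
    intro i
    funext y
    rw [(hasFDerivAt_G y).fderiv]
    simp [kap, EuclideanSpace.inner_single_right]
    ring
  have h2 : ∀ i : Fin 3, fderiv ℝ (fun y => fderiv ℝ (G ε) y (EuclideanSpace.single i 1)) z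
      (EuclideanSpace.single i 1) =
      2 * ε⁻¹ ^ 3 * (gk1 (‖z‖ ^ 2 / ε ^ 2) + z i * (gk2 (‖z‖ ^ 2 / ε ^ 2) * (2 / ε ^ 2 * z i))) := by
    intro i
    rw [h1]
    have hi : HasFDerivAt (fun y : E3 => y i) (EuclideanSpace.proj i : E3 →L[ℝ] ℝ) z :=
      (EuclideanSpace.proj i : E3 →L[ℝ] ℝ).hasFDerivAt
    have := (((hasDerivAt_gk1 (‖z‖ ^ 2 / ε ^ 2)).comp_hasFDerivAt z
      (hasFDerivAt_scal ε z)).mul hi).const_mul (2 * ε⁻¹ ^ 3)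
    have h := this.fderiv
    simp only [Function.comp_def] at h
    erw [h]
    simp [EuclideanSpace.inner_single_right]
    ring
  simp_rw [h2]
  have hn : ‖z‖ ^ 2 = z 0 ^ 2 + z 1 ^ 2 + z 2 ^ 2 := by
    rw [EuclideanSpace.norm_sq_eq]
    simp [Fin.sum_univ_three]
  have h3 := gk_lap (‖z‖ ^ 2 / ε ^ 2)
  unfold rho
  rw [Fin.sum_univ_three]
  have h4 : -(15 / 2 * ε⁻¹ ^ 3 * max 0 (1 - ‖z‖ ^ 2 / ε ^ 2)) =
      ε⁻¹ ^ 3 * (4 * (‖z‖ ^ 2 / ε ^ 2) * gk2 (‖z‖ ^ 2 / ε ^ 2) + 6 * gk1 (‖z‖ ^ 2 / ε ^ 2)) := by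
    rw [h3]; ring
  rw [h4]
  generalize gk2 (‖z‖ ^ 2 / ε ^ 2) = A
  generalize gk1 (‖z‖ ^ 2 / ε ^ 2) = B
  rw [hn]
  ring

lemma G_far {ε : ℝ} (hε : 0 < ε) {z : E3} (h : ε ≤ ‖z‖) : G ε z = ‖z‖⁻¹ := by
  have hz : 0 < ‖z‖ := by linarith
  unfold G gk
  have h1 : 1 ≤ ‖z‖ ^ 2 / ε ^ 2 := by
    rw [le_div_iff₀ (by positivity)]; nlinarith
  split_ifs with h2
  · have : ‖z‖ ^ 2 / ε ^ 2 = 1 := le_antisymm h2 h1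
    rw [this]
    rw [div_eq_one_iff_eq (by positivity)] at this
    have : ‖z‖ = ε := by
      rwa [sq_eq_sq₀ hz.le hε.le] at this
    rw [this]; norm_num
  · rw [Real.sqrt_div (by positivity), Real.sqrt_sq hz.le, Real.sqrt_sq hε.le]
    field_simp

lemma G_near {ε : ℝ} (hε : 0 < ε) {z : E3} (h : ‖z‖ ≤ ε) :
    G ε z = ε⁻¹ * (15 / 8 - 5 / 4 * (‖z‖ / ε) ^ 2 + 3 / 8 * (‖z‖ / ε) ^ 4) := by
  unfold G gk
  rw [if_pos]
  · ring
  · rw [div_le_one (by positivity)]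
    exact pow_le_pow_left₀ (norm_nonneg _) h 2

/-- `15 a - 10 a³ + 3 a⁵` is monotone on `[0,1]`. -/
lemma h_mono {a b : ℝ} (hb : 0 ≤ b) (hab : b ≤ a) (ha : a ≤ 1) :
    15 * b - 10 * b ^ 3 + 3 * b ^ 5 ≤ 15 * a - 10 * a ^ 3 + 3 * a ^ 5 := by
  have : MonotoneOn (fun a : ℝ => 15 * a - 10 * a ^ 3 + 3 * a ^ 5) (Set.Icc 0 1) := by
    have hd : ∀ a : ℝ, HasDerivAt (fun a : ℝ => 15 * a - 10 * a ^ 3 + 3 * a ^ 5)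
        (15 * (1 - a ^ 2) ^ 2) a := by
      intro a
      have := (((hasDerivAt_id a).const_mul 15).sub (((hasDerivAt_id a).pow 3).const_mul 10)).add
        (((hasDerivAt_id a).pow 5).const_mul 3)
      refine this.congr_deriv ?_
      simp; ring
    refine monotoneOn_of_deriv_nonneg (convex_Icc _ _) (fun a _ => (hd a).continuousAt.continuousWithinAt)
      (fun a _ => (hd a).differentiableAt.differentiableWithinAt) ?_
    intro a _
    rw [(hd a).deriv]; positivity
  exact this ⟨hb, by linarith⟩ ⟨by linarith, ha⟩ hab

lemma G_pos {ε : ℝ} (hε : 0 < ε) (z : E3) : 0 < G ε z := by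
  rcases le_total ε ‖z‖ with h | h
  · rw [G_far hε h]; exact inv_pos.2 (by linarith)
  · rw [G_near hε h]
    have h1 : ‖z‖ / ε ≤ 1 := (div_le_one hε).2 h
    have h0 : 0 ≤ ‖z‖ / ε := by positivity
    have : 0 < 15 / 8 - 5 / 4 * (‖z‖ / ε) ^ 2 + 3 / 8 * (‖z‖ / ε) ^ 4 := by nlinarith
    positivity

lemma G_le {ε : ℝ} (hε : 0 < ε) {z : E3} (hz : z ≠ 0) : G ε z ≤ ‖z‖⁻¹ := by
  have hz : 0 < ‖z‖ := norm_pos_iff.2 hz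
  rcases le_total ε ‖z‖ with h | h
  · rw [G_far hε h]
  · rw [G_near hε h]
    have h1 : ‖z‖ / ε ≤ 1 := (div_le_one hε).2 h
    have h0 : 0 ≤ ‖z‖ / ε := by positivity
    have := h_mono h0 h1 le_rfl
    rw [← one_div ‖z‖, le_div_iff₀ hz]
    have h2 : ε⁻¹ * (15 / 8 - 5 / 4 * (‖z‖ / ε) ^ 2 + 3 / 8 * (‖z‖ / ε) ^ 4) * ‖z‖ =
      (15 * (‖z‖ / ε) - 10 * (‖z‖ / ε) ^ 3 + 3 * (‖z‖ / ε) ^ 5) / 8 := by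
      field_simp; ring
    rw [h2]; linarith

lemma G_le_two {ε : ℝ} (hε : 0 < ε) (z : E3) : G ε z ≤ 2 / ε := by
  rcases le_total ε ‖z‖ with h | h
  · rw [G_far hε h, ← one_div]
    gcongr; norm_num
  · rw [G_near hε h]
    have h1 : ‖z‖ / ε ≤ 1 := (div_le_one hε).2 h
    have h0 : 0 ≤ ‖z‖ / ε := by positivity
    have : 15 / 8 - 5 / 4 * (‖z‖ / ε) ^ 2 + 3 / 8 * (‖z‖ / ε) ^ 4 ≤ 2 := by nlinarith [pow_nonneg h0 2, pow_le_one₀ h0 h1 (n := 2)]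
    rw [show 2 / ε = ε⁻¹ * 2 by ring]
    exact mul_le_mul_of_nonneg_left this (by positivity)

lemma G_anti {ε R : ℝ} (hε : 0 < ε) (h : ε ≤ R) (z : E3) : G R z ≤ G ε z := by
  have hR : 0 < R := by linarith
  rcases le_total ε ‖z‖ with h1 | h1
  · rw [G_far hε h1]
    exact G_le hR (norm_pos_iff.1 (by linarith))
  · rcases eq_or_ne z 0 with hz | hz
    · subst hz
      rw [G_near hε h1, G_near hR (by linarith)]
      simp only [norm_zero, zero_div]
      have : R⁻¹ ≤ ε⁻¹ := by gcongr
      linarith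
    · have hz : 0 < ‖z‖ := norm_pos_iff.2 hz
      rw [G_near hε h1, G_near hR (by linarith)]
      have := h_mono (b := ‖z‖ / R) (a := ‖z‖ / ε) (by positivity) (by gcongr) ((div_le_one hε).2 h1)
      have h2 : ∀ ε : ℝ, 0 < ε → ε⁻¹ * (15 / 8 - 5 / 4 * (‖z‖ / ε) ^ 2 + 3 / 8 * (‖z‖ / ε) ^ 4) =
        (15 * (‖z‖ / ε) - 10 * (‖z‖ / ε) ^ 3 + 3 * (‖z‖ / ε) ^ 5) / (8 * ‖z‖) := by
        intro ε hε
        field_simp; ring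
      rw [h2 _ hR, h2 _ hε]
      gcongr

lemma rho_nonneg {ε : ℝ} (hε : 0 < ε) (z : E3) : 0 ≤ rho ε z := by
  unfold rho
  have := le_max_left 0 (1 - ‖z‖ ^ 2 / ε ^ 2)
  positivity

lemma rho_le {ε : ℝ} (hε : 0 < ε) (z : E3) : rho ε z ≤ 15 / 2 * ε⁻¹ ^ 3 := by
  unfold rho
  have : max 0 (1 - ‖z‖ ^ 2 / ε ^ 2) ≤ 1 := by
    apply max_le (by norm_num)
    have : 0 ≤ ‖z‖ ^ 2 / ε ^ 2 := by positivity
    linarith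
  exact mul_le_of_le_one_right (by positivity) this

lemma rho_zero {ε : ℝ} (hε : 0 < ε) {z : E3} (h : ε ≤ ‖z‖) : rho ε z = 0 := by
  unfold rho
  have h1 : 1 ≤ ‖z‖ ^ 2 / ε ^ 2 := by
    rw [le_div_iff₀ (by positivity)]; nlinarith
  rw [max_eq_left (by linarith), mul_zero]

lemma rho_scale {ε : ℝ} (hε : 0 < ε) (w : E3) : rho ε (ε • w) = ε⁻¹ ^ 3 * rho 1 w := by
  unfold rho
  rw [norm_smul, Real.norm_eq_abs, abs_of_pos hε]
  have : (ε * ‖w‖) ^ 2 / ε ^ 2 = ‖w‖ ^ 2 / 1 ^ 2 := by field_simp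
  rw [this]; norm_num; ring

lemma hasCompactSupport_rho {ε : ℝ} (hε : 0 < ε) : HasCompactSupport (rho ε) := by
  refine HasCompactSupport.intro (isCompact_closedBall (0 : E3) ε) ?_
  intro z hz
  apply rho_zero hε
  simp at hz
  exact hz.le

lemma kap_nonneg {ε : ℝ} (hε : 0 < ε) (z : E3) : 0 ≤ kap ε z := by
  unfold kap gk1
  split_ifs with h
  · have : 0 ≤ ε⁻¹ ^ 3 := by positivity
    nlinarith
  · have : 0 ≤ ε⁻¹ ^ 3 * ((‖z‖ ^ 2 / ε ^ 2) * √(‖z‖ ^ 2 / ε ^ 2))⁻¹ := by positivity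
    linarith

lemma kap_far {ε : ℝ} (hε : 0 < ε) {z : E3} (h : ε ≤ ‖z‖) : kap ε z = (‖z‖ ^ 3)⁻¹ := by
  have hz : 0 < ‖z‖ := by linarith
  unfold kap gk1
  have h1 : 1 ≤ ‖z‖ ^ 2 / ε ^ 2 := by
    rw [le_div_iff₀ (by positivity)]; nlinarith
  split_ifs with h2
  · have : ‖z‖ ^ 2 / ε ^ 2 = 1 := le_antisymm h2 h1
    rw [this]
    rw [div_eq_one_iff_eq (by positivity)] at this
    have : ‖z‖ = ε := by
      rwa [sq_eq_sq₀ hz.le hε.le] at this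
    rw [this]; norm_num; ring
  · rw [Real.sqrt_div (by positivity), Real.sqrt_sq hz.le, Real.sqrt_sq hε.le]
    field_simp

lemma kap_le_const {ε : ℝ} (hε : 0 < ε) (z : E3) : kap ε z ≤ 5 / 2 * ε⁻¹ ^ 3 := by
  rcases le_total ε ‖z‖ with h | h
  · rw [kap_far hε h, inv_pow]
    have h2 : (‖z‖ ^ 3)⁻¹ ≤ (ε ^ 3)⁻¹ := by gcongr
    have : 0 ≤ (ε ^ 3)⁻¹ := by positivity
    linarith
  · unfold kap gk1
    have h2 : ‖z‖ ^ 2 / ε ^ 2 ≤ 1 := by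
      rw [div_le_one (by positivity)]
      exact pow_le_pow_left₀ (norm_nonneg _) h 2
    rw [if_pos h2]
    have h1 : 0 ≤ ε⁻¹ ^ 3 := by positivity
    have h3 : 0 ≤ ‖z‖ ^ 2 / ε ^ 2 := by positivity
    nlinarith [mul_nonneg h1 h3]

lemma kap_le {ε : ℝ} (hε : 0 < ε) {z : E3} (hz : z ≠ 0) : kap ε z ≤ (‖z‖ ^ 3)⁻¹ := by
  have hz : 0 < ‖z‖ := norm_pos_iff.2 hz
  rcases le_total ε ‖z‖ with h | h
  · rw [kap_far hε h]
  · unfold kap gk1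
    have h2 : ‖z‖ ^ 2 / ε ^ 2 ≤ 1 := by
      rw [div_le_one (by positivity)]
      exact pow_le_pow_left₀ (norm_nonneg _) h 2
    rw [if_pos h2]
    have h1 : ‖z‖ / ε ≤ 1 := (div_le_one hε).2 h
    have h0 : 0 < ‖z‖ / ε := by positivity
    rw [← one_div (‖z‖ ^ 3), le_div_iff₀ (by positivity)]
    have e : -(2 * ε⁻¹ ^ 3 * (-(5 / 4) + 3 / 4 * (‖z‖ ^ 2 / ε ^ 2))) * ‖z‖ ^ 3 =
      (5 / 2 - 3 / 2 * (‖z‖ / ε) ^ 2) * (‖z‖ / ε) ^ 3 := by field_simp; ring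
    rw [e]
    set a := ‖z‖ / ε
    have : 2 - (5 - 3 * a ^ 2) * a ^ 3 = (1 - a) ^ 2 * (2 + 4 * a + 6 * a ^ 2 + 3 * a ^ 3) := by ring
    have h5 : 0 ≤ (1 - a) ^ 2 * (2 + 4 * a + 6 * a ^ 2 + 3 * a ^ 3) := by positivity
    linarith

end HLE

namespace HLE
open Filter Topology

/-! ### Green identity and the Newtonian representation -/

/-- A bounded positive `C²` function `u` with `-Δ u = f ≥ 0`, `f` continuous. -/
structure PP (u f : E3 → ℝ) : Prop where
  hu : ContDiff ℝ 2 u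
  pos : ∀ x, 0 < u x
  bdd : ∃ M : ℝ, ∀ x, u x ≤ M
  hf : Continuous f
  hf0 : ∀ x, 0 ≤ f x
  eqn : ∀ x, -lap u x = f x

/-- Partial derivative. -/
noncomputable def pd (i : Fin 3) (h : E3 → ℝ) : E3 → ℝ :=
  fun y => fderiv ℝ h y (EuclideanSpace.single i 1)

lemma contDiff_pd {h : E3 → ℝ} {n m : WithTop ℕ∞} (hh : ContDiff ℝ n h) (hm : m + 1 ≤ n) (i : Fin 3) :
    ContDiff ℝ m (pd i h) :=
  (hh.fderiv_right hm).clm_apply contDiff_const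

lemma hcs_pd {h : E3 → ℝ} (hh : HasCompactSupport h) (i : Fin 3) : HasCompactSupport (pd i h) :=
  hh.fderiv_apply ℝ _

lemma ibp {K h : E3 → ℝ} (hK : ContDiff ℝ 1 K) (hh : ContDiff ℝ 1 h)
    (hc : HasCompactSupport K ∨ HasCompactSupport h) (i : Fin 3) :
    ∫ x, K x * pd i h x = -∫ x, pd i K x * h x := by
  have c1 : Continuous (pd i K) := (contDiff_pd (m := 0) hK (by norm_num) i).continuous
  have c2 : Continuous (pd i h) := (contDiff_pd (m := 0) hh (by norm_num) i).continuous
  refine integral_mul_fderiv_eq_neg_fderiv_mul_of_integrable (f := K) (g := h) ?_ ?_ ?_ ?_ ?_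
  · refine (c1.mul hh.continuous).integrable_of_hasCompactSupport ?_
    rcases hc with hc | hc
    · exact (hcs_pd hc i).mul_right
    · exact hc.mul_left
  · refine (hK.continuous.mul c2).integrable_of_hasCompactSupport ?_
    rcases hc with hc | hc
    · exact hc.mul_right
    · exact (hcs_pd hc i).mul_left
  · refine (hK.continuous.mul hh.continuous).integrable_of_hasCompactSupport ?_
    rcases hc with hc | hc
    · exact hc.mul_right
    · exact hc.mul_left
  · intro x _; exact hK.differentiable (by norm_num) x
  · intro x _; exact hh.differentiable (by norm_num) x

lemma lap_eq (h : E3 → ℝ) (x : E3) : lap h x = ∑ i : Fin 3, pd i (pd i h) x := rfl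

lemma green {K u : E3 → ℝ} (hK : ContDiff ℝ 2 K) (hu : ContDiff ℝ 2 u) (hc : HasCompactSupport K) :
    ∫ x, K x * lap u x = ∫ x, lap K x * u x := by
  have K1 : ∀ i, ContDiff ℝ 1 (pd i K) := fun i => contDiff_pd hK (by norm_num) i
  have u1 : ∀ i, ContDiff ℝ 1 (pd i u) := fun i => contDiff_pd hu (by norm_num) i
  have K0 : ∀ i, Continuous (pd i (pd i K)) :=
    fun i => (contDiff_pd (m := 0) (K1 i) (by norm_num) i).continuous
  have u0 : ∀ i, Continuous (pd i (pd i u)) :=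
    fun i => (contDiff_pd (m := 0) (u1 i) (by norm_num) i).continuous
  simp_rw [lap_eq, Finset.mul_sum, Finset.sum_mul]
  rw [integral_finsetSum, integral_finsetSum]
  · refine Finset.sum_congr rfl fun i _ => ?_
    rw [ibp (hK.of_le (by norm_num)) (u1 i) (Or.inl hc) i,
      ibp (K1 i) (hu.of_le (by norm_num)) (Or.inl (hcs_pd hc i)) i, neg_neg]
  · intro i _
    exact ((K0 i).mul hu.continuous).integrable_of_hasCompactSupport (hcs_pd (hcs_pd hc i) i).mul_right
  · intro i _
    exact (hK.continuous.mul (u0 i)).integrable_of_hasCompactSupport hc.mul_right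

lemma lap_sub {K h : E3 → ℝ} (hK : ContDiff ℝ 2 K) (hh : ContDiff ℝ 2 h) (x : E3) :
    lap (fun y => K y - h y) x = lap K x - lap h x := by
  rw [lap_eq, lap_eq, lap_eq, ← Finset.sum_sub_distrib]
  refine Finset.sum_congr rfl fun i _ => ?_
  have e : pd i (fun y => K y - h y) = fun y => pd i K y - pd i h y := by
    funext y
    unfold pd
    rw [fderiv_fun_sub (hK.differentiable (by norm_num) y) (hh.differentiable (by norm_num) y)]
    rfl
  rw [e]
  have K1 : ContDiff ℝ 1 (pd i K) := contDiff_pd hK (by norm_num) i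
  have h1 : ContDiff ℝ 1 (pd i h) := contDiff_pd hh (by norm_num) i
  change fderiv ℝ (fun y => pd i K y - pd i h y) x (EuclideanSpace.single i 1) = _
  rw [fderiv_fun_sub (K1.differentiable (by norm_num) x) (h1.differentiable (by norm_num) x)]
  rfl

lemma lap_translate (u : E3 → ℝ) (x z : E3) : lap (fun z => u (x + z)) z = lap u (x + z) := by
  rw [lap_eq, lap_eq]
  refine Finset.sum_congr rfl fun i _ => ?_
  have e : pd i (fun z => u (x + z)) = fun z => pd i u (x + z) := by
    funext y
    unfold pd
    rw [fderiv_comp_add_left]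
  rw [e]
  change fderiv ℝ (fun z => pd i u (x + z)) z (EuclideanSpace.single i 1) = _
  rw [fderiv_comp_add_left (f := pd i u)]
  rfl

lemma PP.repr {u f : E3 → ℝ} (h : PP u f) (x : E3) {ε R : ℝ} (hε : 0 < ε) (hR : ε ≤ R) :
    ∫ z, f (x + z) * (G ε z - G R z) =
      (∫ z, rho ε z * u (x + z)) - ∫ z, rho R z * u (x + z) := by
  have hR0 : 0 < R := by linarith
  have hu' : ContDiff ℝ 2 (fun z => u (x + z)) := h.hu.comp (contDiff_const.add contDiff_id)
  have hc : HasCompactSupport (fun z => G ε z - G R z) := by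
    refine HasCompactSupport.intro (isCompact_closedBall (0 : E3) R) ?_
    intro z hz
    simp at hz
    rw [G_far hR0 hz.le, G_far hε (by linarith), sub_self]
  have := green ((contDiff_G ε).sub (contDiff_G R)) hu' hc
  have e1 : ∀ z, f (x + z) * (G ε z - G R z) = -((G ε z - G R z) * lap (fun z => u (x + z)) z) := by
    intro z
    rw [lap_translate, ← h.eqn]; ring
  simp_rw [e1]
  rw [integral_neg, this, ← integral_neg, ← integral_sub]
  · refine integral_congr_ae (Eventually.of_forall fun z => ?_)
    simp only
    rw [lap_sub (contDiff_G ε) (contDiff_G R), lap_G hε, lap_G hR0]; ring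
  · exact ((continuous_rho ε).mul hu'.continuous).integrable_of_hasCompactSupport
      (hasCompactSupport_rho hε).mul_right
  · exact ((continuous_rho R).mul hu'.continuous).integrable_of_hasCompactSupport
      (hasCompactSupport_rho hR0).mul_right

/-- The normalising constant (`4π`). -/
noncomputable def c0 : ℝ := ∫ z, rho 1 z

lemma integrable_rho {ε : ℝ} (hε : 0 < ε) : Integrable (rho ε) :=
  (continuous_rho ε).integrable_of_hasCompactSupport (hasCompactSupport_rho hε)

lemma c0_pos : 0 < c0 := by
  unfold c0
  refine (continuous_rho 1).integral_pos_of_hasCompactSupport_nonneg_nonzero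
    (hasCompactSupport_rho one_pos) (rho_nonneg one_pos) (x := 0) ?_
  unfold rho; norm_num

/-- Mollification. -/
noncomputable def U (u : E3 → ℝ) (ε : ℝ) (x : E3) : ℝ := ∫ w, rho 1 w * u (x + ε • w)

lemma U_eq (u : E3 → ℝ) {ε : ℝ} (hε : 0 < ε) (x : E3) :
    ∫ z, rho ε z * u (x + z) = U u ε x := by
  have := Measure.integral_comp_smul volume (fun z : E3 => rho ε z * u (x + z)) ε
  simp only [rho_scale hε] at this
  simp only [finrank_euclideanSpace, Fintype.card_fin, smul_eq_mul] at this
  rw [abs_of_pos (by positivity)] at this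
  unfold U
  have e : ∀ w : E3, ε⁻¹ ^ 3 * rho 1 w * u (x + ε • w) = ε⁻¹ ^ 3 * (rho 1 w * u (x + ε • w)) := by
    intro w; ring
  simp_rw [e] at this
  rw [integral_const_mul, inv_pow] at this
  exact (mul_left_cancel₀ (by positivity) this).symm

lemma U_tendsto {u : E3 → ℝ} (hu : Continuous u) (hb : ∃ M : ℝ, ∀ x, |u x| ≤ M) (x : E3) :
    Tendsto (fun ε => U u ε x) (𝓝 0) (𝓝 (c0 * u x)) := by
  obtain ⟨M, hM⟩ := hb
  have e : c0 * u x = ∫ w, rho 1 w * u (x + (0 : ℝ) • w) := by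
    simp [c0, integral_mul_const]
  rw [e]
  unfold U
  refine tendsto_integral_filter_of_dominated_convergence (fun w => rho 1 w * M) ?_ ?_ ?_ ?_
  · refine Eventually.of_forall fun ε => ?_
    have := continuous_rho 1
    exact Continuous.aestronglyMeasurable (by fun_prop)
  · refine Eventually.of_forall fun ε => Eventually.of_forall fun w => ?_
    rw [norm_mul, Real.norm_eq_abs, abs_of_nonneg (rho_nonneg one_pos w)]
    exact mul_le_mul_of_nonneg_left (hM _) (rho_nonneg one_pos w)
  · exact (integrable_rho one_pos).mul_const M
  · refine Eventually.of_forall fun w => ?_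
    have : Continuous fun ε : ℝ => rho 1 w * u (x + ε • w) := by fun_prop
    exact this.tendsto 0

lemma PP.abs_bdd {u f : E3 → ℝ} (h : PP u f) : ∃ M : ℝ, ∀ x, |u x| ≤ M := by
  obtain ⟨M, hM⟩ := h.bdd
  exact ⟨M, fun x => by rw [abs_of_pos (h.pos x)]; exact hM x⟩

lemma PP.moll_nonneg {u f : E3 → ℝ} (h : PP u f) (x : E3) {R : ℝ} (hR : 0 < R) :
    0 ≤ ∫ z, rho R z * u (x + z) :=
  integral_nonneg fun z => mul_nonneg (rho_nonneg hR z) (h.pos _).le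

lemma PP.cont {u f : E3 → ℝ} (h : PP u f) : Continuous u := h.hu.continuous

lemma G_tendsto_zero (z : E3) : Tendsto (fun R => G R z) atTop (𝓝 0) := by
  have h1 : Tendsto (fun R : ℝ => 2 / R) atTop (𝓝 0) := tendsto_const_nhds.div_atTop tendsto_id
  refine tendsto_of_tendsto_of_tendsto_of_le_of_le' tendsto_const_nhds h1 ?_ ?_
  · filter_upwards [eventually_gt_atTop 0] with R hR using (G_pos hR z).le
  · filter_upwards [eventually_gt_atTop 0] with R hR using G_le_two hR z

lemma PP.lower_aux {u f : E3 → ℝ} (h : PP u f) (x : E3) :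
    ∫⁻ z, ENNReal.ofReal (f (x + z) * ‖z‖⁻¹) ≤ ENNReal.ofReal (c0 * u x) := by
  set ε : ℕ → ℝ := fun n => 1 / ((n : ℝ) + 1) with hε
  set R : ℕ → ℝ := fun n => (n : ℝ) + 1 with hR
  have εpos : ∀ n, 0 < ε n := fun n => by simp only [hε]; positivity
  have εR : ∀ n, ε n ≤ R n := fun n => by
    simp only [hε, hR]
    rw [div_le_iff₀ (by positivity)]
    have : (0 : ℝ) ≤ n := by positivity
    nlinarith
  have εt : Tendsto ε atTop (𝓝 0) := tendsto_one_div_add_atTop_nhds_zero_nat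
  have Rt : Tendsto R atTop atTop := tendsto_atTop_add_const_right _ _ tendsto_natCast_atTop_atTop
  have hmeas : ∀ n, Measurable fun z => ENNReal.ofReal (f (x + z) * (G (ε n) z - G (R n) z)) := by
    intro n
    have := h.hf
    have := continuous_G (ε n)
    have := continuous_G (R n)
    exact Measurable.ennreal_ofReal (Continuous.measurable (by fun_prop))
  have hpt : ∀ᵐ z : E3, ENNReal.ofReal (f (x + z) * ‖z‖⁻¹) =
      liminf (fun n => ENNReal.ofReal (f (x + z) * (G (ε n) z - G (R n) z))) atTop := by
    have : ∀ᵐ z : E3, z ≠ 0 := by simp [ae_iff]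
    filter_upwards [this] with z hz
    refine (Tendsto.liminf_eq ?_).symm
    refine ENNReal.tendsto_ofReal ?_
    refine Tendsto.const_mul _ ?_
    have h1 : Tendsto (fun n => G (ε n) z) atTop (𝓝 ‖z‖⁻¹) := by
      refine tendsto_const_nhds.congr' ?_
      have := εt.eventually (Iio_mem_nhds (norm_pos_iff.2 hz))
      filter_upwards [this] with n hn
      rw [G_far (εpos n) (le_of_lt hn)]
    have h2 := (G_tendsto_zero z).comp Rt
    simpa using h1.sub h2
  rw [lintegral_congr_ae hpt]
  refine (lintegral_liminf_le hmeas).trans ?_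
  have hb : ∀ n, ∫⁻ z, ENNReal.ofReal (f (x + z) * (G (ε n) z - G (R n) z)) ≤
      ENNReal.ofReal (U u (ε n) x) := by
    intro n
    have hc : HasCompactSupport (fun z => G (ε n) z - G (R n) z) := by
      refine HasCompactSupport.intro (isCompact_closedBall (0 : E3) (R n)) ?_
      intro z hz
      simp at hz
      rw [G_far ((εpos n).trans_le (εR n)) hz.le, G_far (εpos n) ((εR n).trans hz.le), sub_self]
    rw [← ofReal_integral_eq_lintegral_ofReal]
    · apply ENNReal.ofReal_le_ofReal
      rw [h.repr x (εpos n) (εR n), U_eq u (εpos n) x]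
      have := h.moll_nonneg x ((εpos n).trans_le (εR n))
      linarith
    · have := h.hf
      have := continuous_G (ε n)
      have := continuous_G (R n)
      exact Continuous.integrable_of_hasCompactSupport (by fun_prop) hc.mul_left
    · refine Eventually.of_forall fun z => mul_nonneg (h.hf0 _) ?_
      exact sub_nonneg.2 (G_anti (εpos n) (εR n) z)
  refine (liminf_le_liminf (Eventually.of_forall hb)).trans ?_
  rw [Tendsto.liminf_eq]
  exact ENNReal.tendsto_ofReal ((U_tendsto h.cont h.abs_bdd x).comp εt)

lemma PP.integrable_aux {u f : E3 → ℝ} (h : PP u f) (x : E3) :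
    Integrable fun z => f (x + z) * ‖z‖⁻¹ := by
  have := h.hf
  refine ⟨?_, ?_⟩
  · have m1 : Measurable fun z => f (x + z) := Continuous.measurable (by fun_prop)
    exact (m1.mul measurable_norm.inv).aestronglyMeasurable
  · rw [hasFiniteIntegral_iff_ofReal]
    · exact (h.lower_aux x).trans_lt ENNReal.ofReal_lt_top
    · exact Eventually.of_forall fun z => mul_nonneg (h.hf0 _) (by positivity)

lemma PP.integrable {u f : E3 → ℝ} (h : PP u f) (x : E3) :
    Integrable fun y => f y * ‖x - y‖⁻¹ := by
  have := (h.integrable_aux x).comp_add_left (-x)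
  refine this.congr (Eventually.of_forall fun y => ?_)
  simp only
  rw [norm_sub_rev]
  congr 2
  · abel
  · congr 1; abel_nf

lemma translate_int (F : E3 → ℝ) (x : E3) : ∫ z, F (x + z) = ∫ y, F y :=
  integral_add_left_eq_self F x

lemma PP.lower {u f : E3 → ℝ} (h : PP u f) (x : E3) :
    ∫ y, f y * ‖x - y‖⁻¹ ≤ c0 * u x := by
  rw [← translate_int _ x]
  have e : ∀ z : E3, f (x + z) * ‖x - (x + z)‖⁻¹ = f (x + z) * ‖z‖⁻¹ := by
    intro z; simp
  simp_rw [e]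
  have := h.lower_aux x
  rw [← ofReal_integral_eq_lintegral_ofReal (h.integrable_aux x)] at this
  · rwa [ENNReal.ofReal_le_ofReal_iff (mul_nonneg c0_pos.le (h.pos x).le)] at this
  · exact Eventually.of_forall fun z => mul_nonneg (h.hf0 _) (by positivity)

/-- Vanishing of averages at infinity. -/
def Van (u : E3 → ℝ) : Prop := ∀ x, Tendsto (fun R => ∫ z, rho R z * u (x + z)) atTop (𝓝 0)

lemma ae_ne_zero : ∀ᵐ z : E3, z ≠ 0 := by simp [ae_iff]
lemma ae_ne (x : E3) : ∀ᵐ z : E3, x - z ≠ 0 := by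
  have : ∀ᵐ z : E3, z ≠ x := by simp [ae_iff]
  filter_upwards [this] with z hz
  exact sub_ne_zero.2 hz.symm

lemma PP.repr2 {u f : E3 → ℝ} (h : PP u f) (hv : Van u) (x : E3) {ε : ℝ} (hε : 0 < ε) :
    ∫ y, f y * G ε (x - y) = U u ε x := by
  rw [← translate_int _ x]
  have e : ∀ z : E3, G ε (x - (x + z)) = G ε z := by
    intro z; simp [G]
  simp_rw [e]
  have t1 : Tendsto (fun R => ∫ z, f (x + z) * (G ε z - G R z)) atTop
      (𝓝 (∫ z, f (x + z) * G ε z)) := by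
    refine tendsto_integral_filter_of_dominated_convergence (fun z => f (x + z) * ‖z‖⁻¹) ?_ ?_
      (h.integrable_aux x) ?_
    · refine Eventually.of_forall fun R => ?_
      have := h.hf
      have := continuous_G ε
      have := continuous_G R
      exact Continuous.aestronglyMeasurable (by fun_prop)
    · filter_upwards [eventually_ge_atTop ε] with R hR
      filter_upwards [ae_ne_zero] with z hz
      have h1 := G_anti hε hR z
      have h2 := G_le hε hz
      have h3 := G_pos (hε.trans_le hR) z
      rw [Real.norm_eq_abs, abs_of_nonneg (mul_nonneg (h.hf0 _) (by linarith))]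
      exact mul_le_mul_of_nonneg_left (by linarith) (h.hf0 _)
    · refine Eventually.of_forall fun z => ?_
      have := (tendsto_const_nhds (x := G ε z)).sub (G_tendsto_zero z)
      rw [sub_zero] at this
      exact this.const_mul _
  have t2 : Tendsto (fun R => ∫ z, f (x + z) * (G ε z - G R z)) atTop (𝓝 (U u ε x)) := by
    have t3 : Tendsto (fun R => U u ε x - ∫ z, rho R z * u (x + z)) atTop (𝓝 (U u ε x - 0)) :=
      tendsto_const_nhds.sub (hv x)
    rw [sub_zero] at t3
    refine t3.congr' ?_
    filter_upwards [eventually_ge_atTop ε] with R hR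
    rw [h.repr x hε hR, U_eq u hε x]
  exact tendsto_nhds_unique t1 t2

lemma PP.upper {u f : E3 → ℝ} (h : PP u f) (hv : Van u) (x : E3) :
    c0 * u x = ∫ y, f y * ‖x - y‖⁻¹ := by
  refine le_antisymm ?_ (h.lower x)
  have t : Tendsto (fun ε => U u ε x) (𝓝[>] 0) (𝓝 (c0 * u x)) :=
    (U_tendsto h.cont h.abs_bdd x).mono_left nhdsWithin_le_nhds
  refine le_of_tendsto t ?_
  filter_upwards [self_mem_nhdsWithin] with ε hε
  rw [← h.repr2 hv x hε]
  refine integral_mono_ae ?_ (h.integrable x) ?_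
  · refine (h.integrable x).mono' ?_ ?_
    · have := h.hf
      have := continuous_G ε
      exact Continuous.aestronglyMeasurable (by fun_prop)
    · filter_upwards [ae_ne x] with y hy
      rw [Real.norm_eq_abs, abs_of_nonneg (mul_nonneg (h.hf0 _) (G_pos hε _).le)]
      exact mul_le_mul_of_nonneg_left (G_le hε hy) (h.hf0 _)
  · filter_upwards [ae_ne x] with y hy
    exact mul_le_mul_of_nonneg_left (G_le hε hy) (h.hf0 _)

/-- Weighted mass. -/
noncomputable def A (f : E3 → ℝ) (R : ℝ) : ℝ := ∫ y, f y * (R + ‖y‖)⁻¹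

lemma A_int_le {f : E3 → ℝ} (hf0 : ∀ x, 0 ≤ f x) {R : ℝ} {x y : E3}
    (hx : ‖x‖ ≤ R) (hy : x - y ≠ 0) : f y * (R + ‖y‖)⁻¹ ≤ f y * ‖x - y‖⁻¹ := by
  refine mul_le_mul_of_nonneg_left ?_ (hf0 y)
  have h1 : 0 < ‖x - y‖ := norm_pos_iff.2 hy
  have h2 := norm_sub_le x y
  gcongr
  linarith

lemma PP.A_integrable {u f : E3 → ℝ} (h : PP u f) {R : ℝ} (hR : 0 < R) :
    Integrable fun y => f y * (R + ‖y‖)⁻¹ := by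
  refine (h.integrable 0).mono' ?_ ?_
  · have := h.hf
    refine Continuous.aestronglyMeasurable (this.mul (Continuous.inv₀ (by fun_prop) ?_))
    intro y; positivity
  · filter_upwards [ae_ne 0] with y hy
    rw [Real.norm_eq_abs, abs_of_nonneg (mul_nonneg (h.hf0 _) (by positivity))]
    exact A_int_le h.hf0 (by simp [hR.le]) hy

lemma PP.A_le {u f : E3 → ℝ} (h : PP u f) {R : ℝ} (hR : 0 < R) {x : E3} (hx : ‖x‖ ≤ R) :
    A f R ≤ c0 * u x := by
  refine le_trans ?_ (h.lower x)
  refine integral_mono_ae (h.A_integrable hR) (h.integrable x) ?_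
  filter_upwards [ae_ne x] with y hy
  exact A_int_le h.hf0 hx hy

/-- Mass in balls versus weighted mass. -/
lemma PP.mass_le {u f : E3 → ℝ} (h : PP u f) {R : ℝ} (hR : 0 < R) {r : ℝ} (hr : 0 ≤ r) :
    ∫ y in Metric.closedBall (0 : E3) r, f y ≤ (R + r) * A f R := by
  unfold A
  rw [← integral_const_mul]
  have hi := (h.A_integrable hR).const_mul (R + r)
  refine le_trans (setIntegral_mono_on (g := fun y => (R + r) * (f y * (R + ‖y‖)⁻¹)) ?_
    hi.integrableOn measurableSet_closedBall ?_) ?_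
  · exact h.hf.continuousOn.integrableOn_compact (isCompact_closedBall _ _)
  · intro y hy
    simp at hy
    have : 1 ≤ (R + r) * (R + ‖y‖)⁻¹ := by
      rw [← div_eq_mul_inv, one_le_div (by positivity)]; linarith
    nlinarith [h.hf0 y]
  · refine setIntegral_le_integral hi (Eventually.of_forall fun y => ?_)
    have := h.hf0 y
    simp only [Pi.zero_apply]
    positivity

end HLE

namespace HLE
open Filter Topology

/-! ### Decay of the weighted mass and vanishing at infinity -/

lemma PP.A_nonneg {u f : E3 → ℝ} (h : PP u f) {R : ℝ} (hR : 0 < R) : 0 ≤ A f R :=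
  integral_nonneg fun y => mul_nonneg (h.hf0 y) (by positivity)

lemma PP.A_pos {u f : E3 → ℝ} (h : PP u f) {R : ℝ} (hR : 0 < R) {x : E3} (hx : f x ≠ 0) :
    0 < A f R := by
  have hc : Continuous fun y => f y * (R + ‖y‖)⁻¹ := by
    refine h.hf.mul (Continuous.inv₀ (by fun_prop) ?_)
    intro y; positivity
  refine integral_pos_of_integrable_nonneg_nonzero (x := x) hc (h.A_integrable hR) ?_ ?_
  · intro y; exact mul_nonneg (h.hf0 y) (by positivity)
  · have : (R + ‖x‖)⁻¹ ≠ 0 := by positivity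
    exact mul_ne_zero hx this

lemma A_growth {u f v g : E3 → ℝ} (hu : PP u f) (hv : PP v g) {q b : ℝ} (hq : 0 < q) (hb : 0 ≤ b)
    (hg : ∀ x, g x = ‖x‖ ^ b * u x ^ q) :
    ∃ c : ℝ, 0 < c ∧ ∀ R, 0 < R → c * R ^ (2 + b) * (A f R) ^ q ≤ A g R := by
  set ω : ℝ := volume.real (Metric.ball (0 : E3) 1) with hω
  have ωpos : 0 < ω := by
    rw [hω, measureReal_def]
    exact ENNReal.toReal_pos (Metric.measure_ball_pos _ _ one_pos).ne' measure_ball_lt_top.ne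
  refine ⟨(1 / 2) ^ b * (c0⁻¹) ^ q * (1 / 2) * (ω / 64), by have := c0_pos; positivity, ?_⟩
  intro R hR
  set x0 : E3 := (3 * R / 4) • EuclideanSpace.single 0 1 with hx0
  have nx0 : ‖x0‖ = 3 * R / 4 := by
    rw [hx0, norm_smul, PiLp.norm_single, norm_one, mul_one, Real.norm_eq_abs,
      abs_of_pos (by positivity)]
  have hA := hu.A_nonneg hR
  have key : ∀ y ∈ Metric.ball x0 (R / 4),
      (R / 2) ^ b * (c0⁻¹ * A f R) ^ q * (2 * R)⁻¹ ≤ g y * (R + ‖y‖)⁻¹ := by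
    intro y hy
    rw [mem_ball_iff_norm] at hy
    have h1 : ‖y‖ ≤ R := by
      have := norm_sub_norm_le y x0; linarith
    have h2 : R / 2 ≤ ‖y‖ := by
      have := norm_sub_norm_le x0 y; rw [norm_sub_rev] at this; linarith
    have h3 := hu.A_le hR h1
    have h4 : c0⁻¹ * A f R ≤ u y := by
      rw [inv_mul_le_iff₀ c0_pos]; exact h3
    have h5 : 0 ≤ c0⁻¹ * A f R := mul_nonneg (inv_nonneg.2 c0_pos.le) hA
    rw [hg]
    have h6 := hu.pos y
    have h7 : (2 * R)⁻¹ ≤ (R + ‖y‖)⁻¹ := by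
      gcongr; linarith
    have h8 : (R / 2) ^ b ≤ ‖y‖ ^ b := Real.rpow_le_rpow (by positivity) h2 hb
    have h9 : (c0⁻¹ * A f R) ^ q ≤ u y ^ q := Real.rpow_le_rpow h5 h4 hq.le
    have h10 : 0 ≤ (c0⁻¹ * A f R) ^ q := Real.rpow_nonneg h5 q
    exact mul_le_mul (mul_le_mul h8 h9 h10 (by positivity)) h7 (by positivity) (by positivity)
  have vol : volume.real (Metric.ball x0 (R / 4)) = R ^ 3 * (ω / 64) := by
    rw [measureReal_def, Measure.addHaar_ball volume x0 (by positivity), ENNReal.toReal_mul,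
      ENNReal.toReal_ofReal (by positivity), ← measureReal_def, ← hω]
    simp only [finrank_euclideanSpace, Fintype.card_fin]
    ring
  have e1 : (1 / 2) ^ b * (c0⁻¹) ^ q * (1 / 2) * (ω / 64) * R ^ (2 + b) * (A f R) ^ q =
      ∫ y in Metric.ball x0 (R / 4), (R / 2) ^ b * (c0⁻¹ * A f R) ^ q * (2 * R)⁻¹ := by
    rw [setIntegral_const, vol, smul_eq_mul, Real.mul_rpow (inv_nonneg.2 c0_pos.le) hA,
      Real.rpow_add hR, show R / 2 = R * (1 / 2) by ring,
      Real.mul_rpow hR.le (by norm_num)]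
    norm_num
    field_simp
  rw [e1]
  have hi := hv.A_integrable hR
  refine le_trans (setIntegral_mono_on ?_ hi.integrableOn measurableSet_ball key) ?_
  · exact integrableOn_const measure_ball_lt_top.ne
  · exact setIntegral_le_integral hi (Eventually.of_forall fun y =>
      mul_nonneg (hv.hf0 y) (by positivity))

lemma A_decay {u f v g : E3 → ℝ} (hu : PP u f) (hv : PP v g) {p q a b : ℝ} (hp : 0 < p) (hq : 0 < q)
    (ha : 0 ≤ a) (hb : 0 ≤ b) (hpq : 1 < p * q)
    (hf : ∀ x, f x = ‖x‖ ^ a * v x ^ p) (hg : ∀ x, g x = ‖x‖ ^ b * u x ^ q) :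
    ∃ C : ℝ, 0 < C ∧ ∀ R, 0 < R → A f R ≤ C * R ^ (-((2 + a + p * (2 + b)) / (p * q - 1))) := by
  obtain ⟨c1, hc1, H1⟩ := A_growth hu hv hq hb hg
  obtain ⟨c2, hc2, H2⟩ := A_growth hv hu hp ha hf
  refine ⟨Real.exp (-(Real.log c2 + p * Real.log c1) / (p * q - 1)), Real.exp_pos _, ?_⟩
  intro R hR
  set e : E3 := EuclideanSpace.single 0 1 with he
  have ne : ‖e‖ = 1 := by rw [he, PiLp.norm_single, norm_one]
  have Af : 0 < A f R := hu.A_pos hR (x := e) (by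
    rw [hf, ne, Real.one_rpow, one_mul]; exact (Real.rpow_pos_of_pos (hv.pos _) _).ne')
  have Ag : 0 < A g R := hv.A_pos hR (x := e) (by
    rw [hg, ne, Real.one_rpow, one_mul]; exact (Real.rpow_pos_of_pos (hu.pos _) _).ne')
  have L1 := Real.log_le_log (by positivity) (H1 R hR)
  have L2 := Real.log_le_log (by positivity) (H2 R hR)
  rw [Real.log_mul (by positivity) (by positivity), Real.log_mul (by positivity) (by positivity),
    Real.log_rpow hR, Real.log_rpow Af] at L1
  rw [Real.log_mul (by positivity) (by positivity), Real.log_mul (by positivity) (by positivity),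
    Real.log_rpow hR, Real.log_rpow Ag] at L2
  rw [← Real.log_le_log_iff Af (by positivity), Real.log_mul (by positivity) (by positivity),
    Real.log_exp, Real.log_rpow hR]
  have hpq' : 0 < p * q - 1 := by linarith
  have L3 := mul_le_mul_of_nonneg_left L1 hp.le
  have e2 : -(Real.log c2 + p * Real.log c1) / (p * q - 1) +
      -((2 + a + p * (2 + b)) / (p * q - 1)) * Real.log R =
      (-(Real.log c2 + p * Real.log c1) - (2 + a + p * (2 + b)) * Real.log R) / (p * q - 1) := by
    ring
  rw [e2, le_div_iff₀ hpq']
  linarith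

lemma vanishing {u f v g : E3 → ℝ} (hu : PP u f) (hv : PP v g) {q b : ℝ} (hq : 0 < q) (hb : 0 ≤ b)
    (hg : ∀ x, g x = ‖x‖ ^ b * u x ^ q) : Van u := by
  intro x
  obtain ⟨M, hM⟩ := hu.bdd
  have hM0 : 0 < M := (hu.pos 0).trans_le (hM 0)
  set ω : ℝ := volume.real (Metric.closedBall (0 : E3) 1) with hω
  have ω0 : 0 ≤ ω := measureReal_nonneg
  have vol : ∀ R : ℝ, 0 ≤ R → volume.real (Metric.closedBall (0 : E3) R) = R ^ 3 * ω := by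
    intro R hR
    rw [Measure.addHaar_real_closedBall' volume 0 hR]
    simp only [finrank_euclideanSpace, Fintype.card_fin]
    rw [← hω]
  have main : ∀ η : ℝ, 0 < η → ∀ᶠ R in atTop, ∫ z, rho R z * u (x + z) ≤ (60 * ω + 1) * η := by
    intro η hη
    set D : ℝ := M * (η ^ q)⁻¹ with hD
    have hD0 : 0 ≤ D := by positivity
    have hIntR : ∀ R : ℝ, 1 ≤ R → ∫ y in Metric.closedBall (0 : E3) (2 * R), u y ≤
        η * (8 * R ^ 3 * ω) + D * ((1 + 2 * R) * A g 1 + M ^ q * ω) := by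
      intro R hR
      set B := Metric.closedBall (0 : E3) (2 * R) with hB
      set B1 := Metric.closedBall (0 : E3) 1 with hB1
      have pt : ∀ y ∈ B, u y ≤ η + D * (g y + B1.indicator (fun _ => M ^ q) y) := by
        intro y _
        have upos := hu.pos y
        have h1 : u y ≤ η + D * u y ^ q := by
          rcases le_total (u y) η with h | h
          · have : 0 ≤ D * u y ^ q := by positivity
            linarith
          · have : (η ^ q)⁻¹ * u y ^ q ≥ 1 := by
              rw [ge_iff_le, ← div_eq_inv_mul, one_le_div (by positivity)]
              exact Real.rpow_le_rpow hη.le h hq.le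
            have : D * u y ^ q ≥ M := by
              rw [hD, mul_assoc]; nlinarith
            linarith [hM y]
        have h2 : u y ^ q ≤ g y + B1.indicator (fun _ => M ^ q) y := by
          by_cases hy : y ∈ B1
          · rw [Set.indicator_of_mem hy]
            have := hv.hf0 y
            have := Real.rpow_le_rpow upos.le (hM y) hq.le
            linarith
          · rw [Set.indicator_of_notMem hy, add_zero, hg]
            simp [hB1] at hy
            have : 1 ≤ ‖y‖ ^ b := Real.one_le_rpow hy.le hb
            have h3 : 0 ≤ u y ^ q := by positivity
            nlinarith
        have := mul_le_mul_of_nonneg_left h2 hD0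
        linarith
      have ig : IntegrableOn g B := hv.hf.continuousOn.integrableOn_compact (isCompact_closedBall _ _)
      have ii : Integrable (B1.indicator (fun _ => M ^ q)) := by
        rw [integrable_indicator_iff measurableSet_closedBall]
        exact integrableOn_const measure_closedBall_lt_top.ne
      have ic : IntegrableOn (fun _ : E3 => η) B := integrableOn_const measure_closedBall_lt_top.ne
      have i2 : IntegrableOn (fun y => D * (g y + B1.indicator (fun _ => M ^ q) y)) B :=
        Integrable.const_mul (ig.add ii.integrableOn) D
      refine (setIntegral_mono_on
        (hu.cont.continuousOn.integrableOn_compact (isCompact_closedBall _ _))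
        (ic.add i2) measurableSet_closedBall pt).trans ?_
      simp only [Pi.add_apply]
      rw [integral_add ic i2, integral_const_mul, integral_add ig ii.integrableOn, setIntegral_const,
        vol _ (by linarith)]
      have m := hv.mass_le one_pos (r := 2 * R) (by linarith)
      have i3 : ∫ y in B, B1.indicator (fun _ => M ^ q) y ≤ M ^ q * ω := by
        refine (setIntegral_le_integral ii (Eventually.of_forall fun y =>
          Set.indicator_nonneg (fun _ _ => by positivity) _)).trans ?_
        rw [integral_indicator measurableSet_closedBall, setIntegral_const, smul_eq_mul, mul_comm]
      have := mul_le_mul_of_nonneg_left (add_le_add m i3) hD0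
      rw [smul_eq_mul]
      refine add_le_add (le_of_eq ?_) this
      ring
    have t : Tendsto (fun R : ℝ => 15 / 2 * D * (A g 1 * (R⁻¹ ^ 3 + 2 * R⁻¹ ^ 2) + M ^ q * ω * R⁻¹ ^ 3))
        atTop (𝓝 (15 / 2 * D * (A g 1 * (0 ^ 3 + 2 * 0 ^ 2) + M ^ q * ω * 0 ^ 3))) := by
      have i := tendsto_inv_atTop_zero (𝕜 := ℝ)
      exact ((((i.pow 3).add ((i.pow 2).const_mul 2)).const_mul _).add
        ((i.pow 3).const_mul _)).const_mul _
    have t2 := t.eventually (gt_mem_nhds (show _ < η by norm_num; exact hη))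
    filter_upwards [t2, eventually_ge_atTop 1, eventually_ge_atTop ‖x‖] with R hR hR1 hRx
    have hR0 : 0 < R := by linarith
    have s1 : ∫ z, rho R z * u (x + z) ≤
        15 / 2 * R⁻¹ ^ 3 * ∫ y in Metric.closedBall (0 : E3) (2 * R), u y := by
      have e : ∀ z, rho R z * u (x + z) = (fun y => rho R (y - x) * u y) (x + z) := by
        intro z; simp
      simp_rw [e]
      rw [translate_int (fun y => rho R (y - x) * u y) x, ← integral_const_mul,
        ← integral_indicator measurableSet_closedBall]
      refine integral_mono ?_ ?_ ?_
      · have := continuous_rho R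
        have := hu.cont
        refine Continuous.integrable_of_hasCompactSupport (by fun_prop) ?_
        refine HasCompactSupport.intro (isCompact_closedBall (0 : E3) (2 * R)) ?_
        intro y hy
        simp at hy
        rw [rho_zero hR0, zero_mul]
        have := norm_sub_norm_le y x; linarith
      · rw [integrable_indicator_iff measurableSet_closedBall]
        exact (hu.cont.const_mul _).continuousOn.integrableOn_compact (isCompact_closedBall _ _)
      · intro y
        by_cases hy : y ∈ Metric.closedBall (0 : E3) (2 * R)
        · rw [Set.indicator_of_mem hy]
          exact mul_le_mul_of_nonneg_right (rho_le hR0 _) (hu.pos y).le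
        · rw [Set.indicator_of_notMem hy]
          simp at hy
          simp only
          rw [rho_zero hR0, zero_mul]
          have := norm_sub_norm_le y x; linarith
    have s2 := mul_le_mul_of_nonneg_left (hIntR R hR1) (show 0 ≤ 15 / 2 * R⁻¹ ^ 3 by positivity)
    refine (s1.trans s2).trans ?_
    have : 15 / 2 * R⁻¹ ^ 3 * (η * (8 * R ^ 3 * ω) + D * ((1 + 2 * R) * A g 1 + M ^ q * ω)) =
      60 * ω * η + 15 / 2 * D * (A g 1 * (R⁻¹ ^ 3 + 2 * R⁻¹ ^ 2) + M ^ q * ω * R⁻¹ ^ 3) := by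
      field_simp
      ring
    rw [this]
    linarith
  rw [Metric.tendsto_nhds]
  intro δ hδ
  have := main (δ / (2 * (60 * ω + 1))) (by positivity)
  filter_upwards [this, eventually_gt_atTop 0] with R hR hR0
  have h0 := hu.moll_nonneg x hR0
  rw [Real.dist_eq, sub_zero, abs_of_nonneg h0]
  refine hR.trans_lt ?_
  rw [show (60 * ω + 1) * (δ / (2 * (60 * ω + 1))) = δ / 2 by field_simp]
  linarith

end HLE

namespace HLE
open Filter Topology

/-! ### Gradient representation -/

lemma kap_bd {ε : ℝ} (hε : 0 < ε) (z : E3) :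
    kap ε z * ‖z‖ * (1 + ‖z‖) ≤ 5 / 2 * (ε⁻¹ ^ 2 + ε⁻¹) := by
  have hn := norm_nonneg z
  rcases le_or_gt ε ‖z‖ with h | h
  · have hz : 0 < ‖z‖ := hε.trans_le h
    rw [kap_far hε h]
    have h1 : ‖z‖⁻¹ ≤ ε⁻¹ := by gcongr
    have h2 : 0 < ‖z‖⁻¹ := by positivity
    have e : (‖z‖ ^ 3)⁻¹ * ‖z‖ * (1 + ‖z‖) = ‖z‖⁻¹ ^ 2 + ‖z‖⁻¹ := by field_simp
    rw [e]
    nlinarith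
  · have h1 := kap_le_const hε z
    have h0 := kap_nonneg hε z
    calc kap ε z * ‖z‖ * (1 + ‖z‖) ≤ (5 / 2 * ε⁻¹ ^ 3) * ε * (1 + ε) := by gcongr
      _ = _ := by field_simp

lemma kap_bd2 {ε : ℝ} (hε : 0 < ε) (x y : E3) :
    kap ε (x - y) * ‖x - y‖ ≤ 5 / 2 * (ε⁻¹ ^ 2 + ε⁻¹) * (1 + ‖x‖) * (1 + ‖y‖)⁻¹ := by
  have h1 := kap_bd hε (x - y)
  have h0 := kap_nonneg hε (x - y)
  have h2 : 1 + ‖y‖ ≤ (1 + ‖x‖) * (1 + ‖x - y‖) := by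
    have : ‖y‖ ≤ ‖x‖ + ‖x - y‖ := by
      have := norm_sub_norm_le y x; rw [norm_sub_rev] at this; linarith
    nlinarith [norm_nonneg x, norm_nonneg (x - y)]
  have hy : 0 < 1 + ‖y‖ := by positivity
  rw [le_mul_inv_iff₀ hy]
  calc kap ε (x - y) * ‖x - y‖ * (1 + ‖y‖)
      ≤ kap ε (x - y) * ‖x - y‖ * ((1 + ‖x‖) * (1 + ‖x - y‖)) := by gcongr
    _ = (kap ε (x - y) * ‖x - y‖ * (1 + ‖x - y‖)) * (1 + ‖x‖) := by ring
    _ ≤ _ := by gcongr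

/-- Gradient kernel integrand. -/
noncomputable def gr (ε : ℝ) (x y : E3) : ℝ := kap ε (x - y) * inner ℝ (x - y) x

lemma continuous_gr (ε : ℝ) : Continuous fun z : E3 × E3 => gr ε z.1 z.2 := by
  have := continuous_kap ε
  unfold gr
  fun_prop

lemma gr_bd {ε : ℝ} (hε : 0 < ε) (x y : E3) :
    |gr ε x y| ≤ 5 / 2 * (ε⁻¹ ^ 2 + ε⁻¹) * (1 + ‖x‖) * (1 + ‖y‖)⁻¹ * ‖x‖ := by
  unfold gr
  rw [abs_mul, abs_of_nonneg (kap_nonneg hε _)]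
  have h1 := kap_bd2 hε x y
  have h2 := abs_real_inner_le_norm (x - y) x
  have h0 := kap_nonneg hε (x - y)
  calc kap ε (x - y) * |inner ℝ (x - y) x| ≤ kap ε (x - y) * (‖x - y‖ * ‖x‖) := by gcongr
    _ = kap ε (x - y) * ‖x - y‖ * ‖x‖ := by ring
    _ ≤ _ := by gcongr

lemma PP.deriv1 {u f : E3 → ℝ} (h : PP u f) (x : E3) {ε : ℝ} (hε : 0 < ε) :
    HasDerivAt (fun t : ℝ => ∫ y, f y * G ε ((1 + t) • x - y)) (-∫ y, f y * gr ε x y) 0 := by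
  have hfc := h.hf
  have hG := continuous_G ε
  have hk := continuous_kap ε
  have key := hasDerivAt_integral_of_dominated_loc_of_deriv_le (μ := (volume : Measure E3))
    (F := fun (t : ℝ) y => f y * G ε ((1 + t) • x - y))
    (F' := fun (t : ℝ) y => f y * (-kap ε ((1 + t) • x - y) * inner ℝ ((1 + t) • x - y) x))
    (x₀ := 0) (s := Metric.ball 0 1)
    (bound := fun y => (5 / 2 * (ε⁻¹ ^ 2 + ε⁻¹) * (1 + 2 * ‖x‖) * ‖x‖) * (f y * (1 + ‖y‖)⁻¹))
    (Metric.ball_mem_nhds _ one_pos)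
    (Eventually.of_forall fun t => Continuous.aestronglyMeasurable (by fun_prop)) ?_
    (Continuous.aestronglyMeasurable (by fun_prop)) ?_ ?_ ?_
  · have e : -∫ y, f y * gr ε x y = ∫ y, f y * (-kap ε ((1 + (0 : ℝ)) • x - y) *
        inner ℝ ((1 + (0 : ℝ)) • x - y) x) := by
      rw [← integral_neg]
      congr 1; ext y; simp only [gr, add_zero, one_smul]; ring
    rw [e]; exact key.2
  · simp only [add_zero, one_smul]
    refine (h.integrable x).mono' (Continuous.aestronglyMeasurable (by fun_prop)) ?_
    filter_upwards [ae_ne x] with y hy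
    rw [Real.norm_eq_abs, abs_of_nonneg (mul_nonneg (h.hf0 _) (G_pos hε _).le)]
    exact mul_le_mul_of_nonneg_left (G_le hε hy) (h.hf0 _)
  · refine Eventually.of_forall fun y t ht => ?_
    rw [mem_ball_zero_iff, Real.norm_eq_abs, abs_lt] at ht
    have n1 : ‖(1 + t) • x‖ ≤ 2 * ‖x‖ := by
      rw [norm_smul, Real.norm_eq_abs, abs_of_pos (by linarith)]
      gcongr; linarith
    have h1 := kap_bd2 hε ((1 + t) • x) y
    have h2 := abs_real_inner_le_norm ((1 + t) • x - y) x
    have h0 := kap_nonneg hε ((1 + t) • x - y)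
    have hf0 := h.hf0 y
    rw [Real.norm_eq_abs, abs_mul, abs_mul, abs_neg, abs_of_nonneg hf0, abs_of_nonneg h0]
    calc f y * (kap ε ((1 + t) • x - y) * |inner ℝ ((1 + t) • x - y) x|)
        ≤ f y * (kap ε ((1 + t) • x - y) * (‖(1 + t) • x - y‖ * ‖x‖)) := by gcongr
      _ = f y * ((kap ε ((1 + t) • x - y) * ‖(1 + t) • x - y‖) * ‖x‖) := by ring
      _ ≤ f y * ((5 / 2 * (ε⁻¹ ^ 2 + ε⁻¹) * (1 + ‖(1 + t) • x‖) * (1 + ‖y‖)⁻¹) * ‖x‖) := by gcongr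
      _ ≤ f y * ((5 / 2 * (ε⁻¹ ^ 2 + ε⁻¹) * (1 + 2 * ‖x‖) * (1 + ‖y‖)⁻¹) * ‖x‖) := by gcongr
      _ = _ := by ring
  · exact (h.A_integrable one_pos).const_mul _
  · refine Eventually.of_forall fun y t _ => ?_
    have d1 : HasDerivAt (fun t : ℝ => (1 + t) • x - y) x t := by
      simpa using (((hasDerivAt_id t).const_add 1).smul_const x).sub_const y
    have d2 := ((hasFDerivAt_G (ε := ε) ((1 + t) • x - y)).comp_hasDerivAt t d1).const_mul (f y)
    have e : f y * (((-kap ε ((1 + t) • x - y)) • innerSL ℝ ((1 + t) • x - y)) x) =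
        f y * (-kap ε ((1 + t) • x - y) * inner ℝ ((1 + t) • x - y) x) := rfl
    rw [← e]; exact d2

/-- Mollified radial derivative. -/
noncomputable def Ur (u : E3 → ℝ) (ε : ℝ) (x : E3) : ℝ :=
  ∫ w in Metric.closedBall (0 : E3) 1, rho 1 w * fderiv ℝ u (x + ε • w) x

lemma setint_rho (F : E3 → ℝ) : ∫ w, rho 1 w * F w = ∫ w in Metric.closedBall (0 : E3) 1, rho 1 w * F w := by
  rw [setIntegral_eq_integral_of_forall_compl_eq_zero]
  intro w hw
  rw [mem_closedBall_zero_iff, not_le] at hw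
  rw [rho_zero one_pos hw.le, zero_mul]

lemma PP.cfd {u f : E3 → ℝ} (h : PP u f) : Continuous (fderiv ℝ u) :=
  h.hu.continuous_fderiv (by norm_num)

lemma PP.deriv2 {u f : E3 → ℝ} (h : PP u f) (x : E3) {ε : ℝ}  :
    HasDerivAt (fun t : ℝ => U u ε ((1 + t) • x)) (Ur u ε x) 0 := by
  have hfd := h.cfd
  have hc := h.cont
  have hr := continuous_rho 1
  have hU : (fun t : ℝ => U u ε ((1 + t) • x)) =
      fun t : ℝ => ∫ w in Metric.closedBall (0 : E3) 1, rho 1 w * u ((1 + t) • x + ε • w) := by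
    ext t; exact setint_rho _
  rw [hU]
  have cF : Continuous fun z : ℝ × E3 => rho 1 z.2 * fderiv ℝ u ((1 + z.1) • x + ε • z.2) x := by
    fun_prop
  obtain ⟨C, hC⟩ := ((isCompact_closedBall (0 : ℝ) 1).prod
    (isCompact_closedBall (0 : E3) 1)).exists_bound_of_continuousOn cF.continuousOn
  have key := hasDerivAt_integral_of_dominated_loc_of_deriv_le
    (μ := (volume : Measure E3).restrict (Metric.closedBall (0 : E3) 1))
    (F := fun (t : ℝ) w => rho 1 w * u ((1 + t) • x + ε • w))
    (F' := fun (t : ℝ) w => rho 1 w * fderiv ℝ u ((1 + t) • x + ε • w) x)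
    (x₀ := 0) (s := Metric.ball 0 1)
    (bound := fun y => C)
    (Metric.ball_mem_nhds _ one_pos)
    (Eventually.of_forall fun t => Continuous.aestronglyMeasurable (by fun_prop)) ?_
    (Continuous.aestronglyMeasurable (by fun_prop)) ?_ ?_ ?_
  · have e : Ur u ε x = ∫ w in Metric.closedBall (0 : E3) 1,
        rho 1 w * fderiv ℝ u ((1 + (0 : ℝ)) • x + ε • w) x := by
      simp only [Ur, add_zero, one_smul]
    rw [e]; exact key.2
  · exact ContinuousOn.integrableOn_compact (isCompact_closedBall (0 : E3) 1)
      (Continuous.continuousOn (by fun_prop))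
  · filter_upwards [ae_restrict_mem measurableSet_closedBall] with w hw t ht
    exact hC (t, w) ⟨Metric.ball_subset_closedBall ht, hw⟩
  · have : IsFiniteMeasure ((volume : Measure E3).restrict (Metric.closedBall (0 : E3) 1)) :=
      isFiniteMeasure_restrict.2 measure_closedBall_lt_top.ne
    exact integrable_const C
  · refine Eventually.of_forall fun w t _ => ?_
    have d1 : HasDerivAt (fun t : ℝ => (1 + t) • x + ε • w) x t := by
      simpa using (((hasDerivAt_id t).const_add 1).smul_const x).add_const (ε • w)
    have d0 : DifferentiableAt ℝ u ((1 + t) • x + ε • w) := h.hu.differentiable (by norm_num) _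
    exact (d0.hasFDerivAt.comp_hasDerivAt t d1).const_mul _

lemma PP.grad_repr {u f : E3 → ℝ} (h : PP u f) (hv : Van u) (x : E3) {ε : ℝ} (hε : 0 < ε) :
    -∫ y, f y * gr ε x y = Ur u ε x := by
  have h1 := h.deriv1 x hε
  simp_rw [h.repr2 hv _ hε] at h1
  exact h1.unique (h.deriv2 x)

lemma continuous_Ur {u f : E3 → ℝ} (h : PP u f) : Continuous fun z : ℝ × E3 => Ur u z.1 z.2 := by
  have hfd := h.cfd
  have hr := continuous_rho 1
  unfold Ur
  refine continuous_parametric_integral_of_continuous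
    (f := fun (z : ℝ × E3) w => rho 1 w * fderiv ℝ u (z.2 + z.1 • w) z.2) ?_ (isCompact_closedBall _ _)
  simp only [Function.uncurry_def]
  fun_prop

lemma Ur_zero (u : E3 → ℝ) (x : E3) : Ur u 0 x = c0 * fderiv ℝ u x x := by
  unfold Ur
  rw [← setint_rho (fun w => fderiv ℝ u (x + (0 : ℝ) • w) x)]
  simp [c0, integral_mul_const]

lemma PP.grad_tendsto {u f : E3 → ℝ} (h : PP u f) {k : E3 → ℝ} (hk : Continuous k) 
    (hc : HasCompactSupport k) :
    Tendsto (fun ε => ∫ x, k x * Ur u ε x) (𝓝[>] 0) (𝓝 (c0 * ∫ x, k x * fderiv ℝ u x x)) := by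
  have hU := continuous_Ur h
  have e1 : ∀ ε, ∫ x, k x * Ur u ε x = ∫ x in tsupport k, k x * Ur u ε x := by
    intro ε
    rw [setIntegral_eq_integral_of_forall_compl_eq_zero]
    intro w hw
    rw [image_eq_zero_of_notMem_tsupport hw, zero_mul]
  have c1 : Continuous fun ε => ∫ x in tsupport k, k x * Ur u ε x := by
    refine continuous_parametric_integral_of_continuous
      (f := fun (ε : ℝ) x => k x * Ur u ε x) ?_ hc
    simp only [Function.uncurry_def]
    fun_prop
  simp_rw [e1]
  have := (c1.tendsto 0).mono_left (nhdsWithin_le_nhds (s := Set.Ioi 0))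
  convert this using 2
  rw [← e1]
  simp_rw [Ur_zero u]
  rw [← integral_const_mul]
  congr 1; ext x; ring
end HLE

namespace HLE
open Filter Topology

/-! ### Pohozaev inequality -/

/-- Commutator kernel. -/
noncomputable def Kn (φ : E3 → ℝ) (x y : E3) : ℝ := |φ x - φ y| * ((‖x‖ + ‖y‖) * (‖x - y‖ ^ 2)⁻¹)

lemma Kn_nonneg (φ : E3 → ℝ) (x y : E3) : 0 ≤ Kn φ x y := by unfold Kn; positivity

lemma Kn_symm (φ : E3 → ℝ) (x y : E3) : Kn φ x y = Kn φ y x := by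
  unfold Kn; rw [abs_sub_comm, norm_sub_rev, add_comm ‖x‖]

lemma ae_prod_ne : ∀ᵐ z : E3 × E3 ∂(volume.prod volume), z.1 - z.2 ≠ 0 := by
  rw [Measure.ae_prod_iff_ae_ae]
  · exact Eventually.of_forall fun x => ae_ne x
  · exact (isOpen_ne_fun (by fun_prop) (by fun_prop)).measurableSet

lemma gr_int {u f : E3 → ℝ} (h : PP u f) {k : E3 → ℝ} (hk : Continuous k)
    (hc : HasCompactSupport k) {ε : ℝ} (hε : 0 < ε) :
    Integrable (fun z : E3 × E3 => k z.1 * (f z.2 * gr ε z.1 z.2)) (volume.prod volume) := by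
  have i1 : Integrable (fun x => k x * ((5 / 2 * (ε⁻¹ ^ 2 + ε⁻¹) * (1 + ‖x‖)) * ‖x‖)) := by
    refine Continuous.integrable_of_hasCompactSupport (by fun_prop) hc.mul_right
  have i2 := i1.abs.mul_prod (h.A_integrable one_pos)
  have hf := h.hf
  have hg := continuous_gr ε
  refine i2.mono' (Continuous.aestronglyMeasurable (by fun_prop)) ?_
  refine Eventually.of_forall fun z => ?_
  have h1 := gr_bd hε z.1 z.2
  have h0 := h.hf0 z.2
  rw [Real.norm_eq_abs, abs_mul, abs_mul, abs_of_nonneg h0, abs_mul,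
    abs_of_nonneg (a := 5 / 2 * (ε⁻¹ ^ 2 + ε⁻¹) * (1 + ‖z.1‖) * ‖z.1‖) (by positivity)]
  calc |k z.1| * (f z.2 * |gr ε z.1 z.2|)
      ≤ |k z.1| * (f z.2 * (5 / 2 * (ε⁻¹ ^ 2 + ε⁻¹) * (1 + ‖z.1‖) * (1 + ‖z.2‖)⁻¹ * ‖z.1‖)) := by gcongr
    _ = _ := by ring

lemma gr_int_eq {u f : E3 → ℝ} (h : PP u f) (hv : Van u) {k : E3 → ℝ} (hk : Continuous k)
    (hc : HasCompactSupport k) {ε : ℝ} (hε : 0 < ε) :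
    ∫ z : E3 × E3, k z.1 * (f z.2 * gr ε z.1 z.2) ∂(volume.prod volume) = -∫ x, k x * Ur u ε x := by
  rw [integral_prod _ (gr_int h hk hc hε), ← integral_neg]
  congr 1; ext x
  simp only []
  rw [integral_const_mul, ← h.grad_repr hv x hε]; ring

lemma pot_int {u f : E3 → ℝ} (h : PP u f) (hv : Van u) {k : E3 → ℝ} (hk : Continuous k)
    (hc : HasCompactSupport k) :
    Integrable (fun z : E3 × E3 => k z.1 * (f z.2 * ‖z.1 - z.2‖⁻¹)) (volume.prod volume) := by
  have hf := h.hf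
  have hu := h.cont
  have m : AEStronglyMeasurable (fun z : E3 × E3 => k z.1 * (f z.2 * ‖z.1 - z.2‖⁻¹))
      (volume.prod volume) := by
    refine Measurable.aestronglyMeasurable ?_
    have := hk.measurable
    have := hf.measurable
    fun_prop
  rw [integrable_prod_iff m]
  refine ⟨Eventually.of_forall fun x => (h.integrable x).const_mul (k x), ?_⟩
  have e : (fun x => ∫ y, ‖k x * (f y * ‖x - y‖⁻¹)‖) = fun x => |k x| * (c0 * u x) := by
    ext x
    rw [h.upper hv, ← integral_const_mul]
    congr 1; ext y
    rw [Real.norm_eq_abs, abs_mul, abs_of_nonneg (a := f y * _)]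
    exact mul_nonneg (h.hf0 y) (by positivity)
  simp only [e]
  refine Continuous.integrable_of_hasCompactSupport (by fun_prop) ?_
  exact HasCompactSupport.mul_right (hc.norm)

lemma pot_int_eq {u f : E3 → ℝ} (h : PP u f) (hv : Van u) {k : E3 → ℝ} (hk : Continuous k)
    (hc : HasCompactSupport k) :
    ∫ z : E3 × E3, k z.1 * (f z.2 * ‖z.1 - z.2‖⁻¹) ∂(volume.prod volume) = c0 * ∫ x, k x * u x := by
  rw [integral_prod _ (pot_int h hv hk hc), ← integral_const_mul]
  congr 1; ext x
  simp only []
  rw [integral_const_mul, ← h.upper hv x]; ring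

lemma gr_pt {φ : E3 → ℝ} {ε : ℝ} (hε : 0 < ε) {x y : E3} (hφ : 0 ≤ φ x) (hz : x - y ≠ 0) :
    φ x * gr ε x y + φ y * gr ε y x ≤ φ x * ‖x - y‖⁻¹ + Kn φ x y := by
  have n0 : 0 < ‖x - y‖ := norm_pos_iff.2 hz
  have hk := kap_le hε hz
  have hk0 := kap_nonneg hε (x - y)
  have ks : kap ε (y - x) = kap ε (x - y) := by unfold kap; rw [norm_sub_rev]
  have e : φ x * gr ε x y + φ y * gr ε y x =
      kap ε (x - y) * (φ x * ‖x - y‖ ^ 2 + (φ x - φ y) * inner ℝ (x - y) y) := by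
    unfold gr
    rw [ks, ← real_inner_self_eq_norm_sq]
    simp only [inner_sub_left, inner_sub_right, real_inner_comm y x]
    ring
  have h1 : (φ x - φ y) * inner ℝ (x - y) y ≤ |φ x - φ y| * (‖x - y‖ * (‖x‖ + ‖y‖)) := by
    refine (le_abs_self _).trans ?_
    rw [abs_mul]
    have := abs_real_inner_le_norm (x - y) y
    gcongr
    refine this.trans ?_
    have := norm_nonneg x
    gcongr; linarith
  rw [e]
  calc _ ≤ kap ε (x - y) * (φ x * ‖x - y‖ ^ 2 + |φ x - φ y| * (‖x - y‖ * (‖x‖ + ‖y‖))) := by gcongr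
    _ ≤ (‖x - y‖ ^ 3)⁻¹ * (φ x * ‖x - y‖ ^ 2 + |φ x - φ y| * (‖x - y‖ * (‖x‖ + ‖y‖))) := by gcongr
    _ = _ := by unfold Kn; field_simp

lemma poh_eps {u f v g φ : E3 → ℝ} (hu : PP u f) (hv : PP v g) (Vu : Van u) (Vv : Van v)
    (hφ : Continuous φ) (hc : HasCompactSupport φ) (hφ0 : ∀ x, 0 ≤ φ x)
    (hE : Integrable (fun z : E3 × E3 => g z.1 * f z.2 * Kn φ z.1 z.2) (volume.prod volume))
    {ε : ℝ} (hε : 0 < ε) :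
    -((∫ x, (φ x * g x) * Ur u ε x) + ∫ x, (φ x * f x) * Ur v ε x) ≤
      c0 * (∫ x, (φ x * g x) * u x) + ∫ z : E3 × E3, g z.1 * f z.2 * Kn φ z.1 z.2 ∂(volume.prod volume) := by
  have hf := hu.hf
  have hg := hv.hf
  have cg : Continuous fun x => φ x * g x := by fun_prop
  have cf : Continuous fun x => φ x * f x := by fun_prop
  have sg : HasCompactSupport fun x => φ x * g x := hc.mul_right
  have sf : HasCompactSupport fun x => φ x * f x := hc.mul_right
  have i1 := gr_int hu cg sg hε
  have i2 : Integrable (fun z : E3 × E3 => φ z.swap.1 * f z.swap.1 *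
      (g z.swap.2 * gr ε z.swap.1 z.swap.2)) (volume.prod volume) := (gr_int hv cf sf hε).swap
  have i3 := pot_int hu Vu cg sg
  have e1 := gr_int_eq hu Vu cg sg hε
  have e2 := gr_int_eq hv Vv cf sf hε
  have e3 := pot_int_eq hu Vu cg sg
  rw [← integral_prod_swap] at e2
  have : -((∫ x, (φ x * g x) * Ur u ε x) + ∫ x, (φ x * f x) * Ur v ε x) =
    (-∫ x, (φ x * g x) * Ur u ε x) + -∫ x, (φ x * f x) * Ur v ε x := by ring
  rw [this, ← e1, ← e2, ← e3, ← integral_add i1 i2, ← integral_add i3 hE]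
  refine integral_mono_ae (i1.add i2) (i3.add hE) ?_
  filter_upwards [ae_prod_ne] with z hz
  have h1 := gr_pt hε (hφ0 z.1) hz
  have h2 := mul_le_mul_of_nonneg_left h1 (mul_nonneg (hv.hf0 z.1) (hu.hf0 z.2))
  simp only [Prod.fst_swap, Prod.snd_swap]
  calc _ = g z.1 * f z.2 * (φ z.1 * gr ε z.1 z.2 + φ z.2 * gr ε z.2 z.1) := by ring
    _ ≤ _ := h2
    _ = _ := by ring

lemma poh1 {u f v g φ : E3 → ℝ} (hu : PP u f) (hv : PP v g) (Vu : Van u) (Vv : Van v)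
    (hφ : Continuous φ) (hc : HasCompactSupport φ) (hφ0 : ∀ x, 0 ≤ φ x)
    (hE : Integrable (fun z : E3 × E3 => g z.1 * f z.2 * Kn φ z.1 z.2) (volume.prod volume)) :
    -(c0 * (∫ x, (φ x * g x) * fderiv ℝ u x x) + c0 * ∫ x, (φ x * f x) * fderiv ℝ v x x) ≤
      c0 * (∫ x, (φ x * g x) * u x) + ∫ z : E3 × E3, g z.1 * f z.2 * Kn φ z.1 z.2 ∂(volume.prod volume) := by
  have hf := hu.hf
  have hg := hv.hf
  have t1 := hu.grad_tendsto (k := fun x => φ x * g x) (by fun_prop) hc.mul_right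
  have t2 := hv.grad_tendsto (k := fun x => φ x * f x) (by fun_prop) hc.mul_right
  refine le_of_tendsto (t1.add t2).neg ?_
  filter_upwards [self_mem_nhdsWithin] with ε hε
  exact poh_eps hu hv Vu Vv hφ hc hφ0 hE hε

lemma poh2 {u f v g φ : E3 → ℝ} (hu : PP u f) (hv : PP v g) (Vu : Van u) (Vv : Van v)
    (hφ : Continuous φ) (hc : HasCompactSupport φ)
    (hE : Integrable (fun z : E3 × E3 => g z.1 * f z.2 * Kn φ z.1 z.2) (volume.prod volume)) :
    c0 * (∫ x, (φ x * g x) * u x) ≤ c0 * (∫ x, (φ x * f x) * v x) + 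
      ∫ z : E3 × E3, g z.1 * f z.2 * Kn φ z.1 z.2 ∂(volume.prod volume) := by
  have hf := hu.hf
  have hg := hv.hf
  have cg : Continuous fun x => φ x * g x := by fun_prop
  have cf : Continuous fun x => φ x * f x := by fun_prop
  have sg : HasCompactSupport fun x => φ x * g x := hc.mul_right
  have sf : HasCompactSupport fun x => φ x * f x := hc.mul_right
  have i1 := pot_int hu Vu cg sg
  have i2 : Integrable (fun z : E3 × E3 => φ z.swap.1 * f z.swap.1 *
      (g z.swap.2 * ‖z.swap.1 - z.swap.2‖⁻¹)) (volume.prod volume) := (pot_int hv Vv cf sf).swap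
  have e1 := pot_int_eq hu Vu cg sg
  have e2 := pot_int_eq hv Vv cf sf
  rw [← integral_prod_swap] at e2
  rw [← e1, ← e2, ← integral_add i2 hE]
  refine integral_mono_ae i1 (i2.add hE) ?_
  filter_upwards [ae_prod_ne] with z hz
  have n0 : 0 < ‖z.1 - z.2‖ := norm_pos_iff.2 hz
  have h1 : φ z.1 * ‖z.1 - z.2‖⁻¹ ≤ φ z.2 * ‖z.1 - z.2‖⁻¹ + Kn φ z.1 z.2 := by
    have h3 : ‖z.1 - z.2‖⁻¹ ≤ (‖z.1‖ + ‖z.2‖) * (‖z.1 - z.2‖ ^ 2)⁻¹ := by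
      have := norm_sub_le z.1 z.2
      rw [le_mul_inv_iff₀ (by positivity)]
      calc _ = ‖z.1 - z.2‖ := by field_simp
        _ ≤ _ := this
    have h4 : (φ z.1 - φ z.2) * ‖z.1 - z.2‖⁻¹ ≤ |φ z.1 - φ z.2| * ((‖z.1‖ + ‖z.2‖) * (‖z.1 - z.2‖ ^ 2)⁻¹) := by
      refine (mul_le_mul_of_nonneg_right (le_abs_self _) (by positivity)).trans ?_
      gcongr
    unfold Kn; linarith
  have h2 := mul_le_mul_of_nonneg_left h1 (mul_nonneg (hv.hf0 z.1) (hu.hf0 z.2))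
  simp only [Prod.fst_swap, Prod.snd_swap]
  rw [norm_sub_rev z.2 z.1]
  calc _ = g z.1 * f z.2 * (φ z.1 * ‖z.1 - z.2‖⁻¹) := by ring
    _ ≤ _ := h2
    _ = _ := by ring

/-! ### Dilation identity -/

lemma dil {b : ℝ} (hb : 0 ≤ b) {k : E3 → ℝ} (hk : ContDiff ℝ 1 k) (hc : HasCompactSupport k) :
    ∫ x, ‖x‖ ^ b * fderiv ℝ k x x = -(3 + b) * ∫ x, ‖x‖ ^ b * k x := by
  have cb : Continuous fun x : E3 => ‖x‖ ^ b := continuous_norm.rpow_const fun x => Or.inr hb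
  have ck := hk.continuous
  have cd : Continuous (fderiv ℝ k) := hk.continuous_fderiv (by norm_num)
  obtain ⟨r, hr0, hr⟩ : ∃ r : ℝ, 0 < r ∧ ∀ x, r < ‖x‖ → k x = 0 := by
    obtain ⟨r, hr⟩ := hc.isCompact.isBounded.subset_closedBall (0 : E3)
    refine ⟨max r 1, by positivity, fun x hx => image_eq_zero_of_notMem_tsupport fun h => ?_⟩
    have := hr h
    rw [mem_closedBall_zero_iff] at this
    exact absurd (this.trans (le_max_left r 1)) (not_le.2 hx)
  -- first derivative computation
  have I : ∀ t : ℝ, |t| < 1 / 2 → ∫ x, ‖x‖ ^ b * k ((1 + t) • x) = (1 + t) ^ (-(3 + b)) * ∫ x, ‖x‖ ^ b * k x := by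
    intro t ht
    rw [abs_lt] at ht
    have t0 : 0 < 1 + t := by linarith
    have e : ∀ x : E3, ‖x‖ ^ b * k ((1 + t) • x) =
        (1 + t) ^ (-b) * (fun y => ‖y‖ ^ b * k y) ((1 + t) • x) := by
      intro x
      simp only
      rw [norm_smul, Real.norm_eq_abs, abs_of_pos t0, Real.mul_rpow t0.le (norm_nonneg x),
        Real.rpow_neg t0.le]
      have : (1 + t) ^ b ≠ 0 := (Real.rpow_pos_of_pos t0 b).ne'
      field_simp
    simp_rw [e]
    rw [integral_const_mul, Measure.integral_comp_smul volume (fun y : E3 => ‖y‖ ^ b * k y)]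
    simp only [finrank_euclideanSpace, Fintype.card_fin, smul_eq_mul]
    rw [abs_of_pos (by positivity), ← mul_assoc]
    congr 1
    rw [neg_add, Real.rpow_add t0, Real.rpow_neg t0.le 3]
    norm_num [mul_comm]
  have d1 : HasDerivAt (fun t : ℝ => ∫ x, ‖x‖ ^ b * k ((1 + t) • x)) (-(3 + b) * ∫ x, ‖x‖ ^ b * k x) 0 := by
    have h1 : HasDerivAt (fun t : ℝ => (1 + t) ^ (-(3 + b))) (-(3 + b)) 0 := by
      have := ((hasDerivAt_id (0 : ℝ)).const_add 1).rpow_const (p := -(3 + b)) (Or.inl (by simp))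
      simpa using this
    refine (h1.mul_const _).congr_of_eventuallyEq ?_
    filter_upwards [Metric.ball_mem_nhds (0 : ℝ) (ε := 1 / 2) (by norm_num)] with t ht
    rw [mem_ball_zero_iff, Real.norm_eq_abs] at ht
    exact I t ht
  -- second
  have cF : Continuous fun z : ℝ × E3 => ‖z.2‖ ^ b * fderiv ℝ k ((1 + z.1) • z.2) z.2 := by
    fun_prop
  obtain ⟨C, hC⟩ := ((isCompact_closedBall (0 : ℝ) (1 / 2)).prod
    (isCompact_closedBall (0 : E3) (2 * r))).exists_bound_of_continuousOn cF.continuousOn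
  have out : ∀ t : ℝ, |t| < 1 / 2 → ∀ x : E3, x ∉ Metric.closedBall (0 : E3) (2 * r) → k ((1 + t) • x) = 0 := by
    intro t ht x hx
    rw [abs_lt] at ht
    rw [mem_closedBall_zero_iff, not_le] at hx
    refine hr _ ?_
    rw [norm_smul, Real.norm_eq_abs, abs_of_pos (by linarith)]
    nlinarith
  have d2 : HasDerivAt (fun t : ℝ => ∫ x in Metric.closedBall (0 : E3) (2 * r), ‖x‖ ^ b * k ((1 + t) • x))
      (∫ x in Metric.closedBall (0 : E3) (2 * r), ‖x‖ ^ b * fderiv ℝ k x x) 0 := by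
    have key := hasDerivAt_integral_of_dominated_loc_of_deriv_le
      (μ := (volume : Measure E3).restrict (Metric.closedBall (0 : E3) (2 * r)))
      (F := fun (t : ℝ) x => ‖x‖ ^ b * k ((1 + t) • x))
      (F' := fun (t : ℝ) x => ‖x‖ ^ b * fderiv ℝ k ((1 + t) • x) x)
      (x₀ := 0) (s := Metric.ball 0 (1 / 2))
      (bound := fun y => C)
      (Metric.ball_mem_nhds _ (by norm_num))
      (Eventually.of_forall fun t => Continuous.aestronglyMeasurable (by fun_prop)) ?_
      (Continuous.aestronglyMeasurable (by fun_prop)) ?_ ?_ ?_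
    · have e : ∫ x in Metric.closedBall (0 : E3) (2 * r), ‖x‖ ^ b * fderiv ℝ k x x =
          ∫ x in Metric.closedBall (0 : E3) (2 * r), ‖x‖ ^ b * fderiv ℝ k ((1 + (0 : ℝ)) • x) x := by
        simp only [add_zero, one_smul]
      rw [e]; exact key.2
    · exact ContinuousOn.integrableOn_compact (isCompact_closedBall (0 : E3) _)
        (Continuous.continuousOn (by fun_prop))
    · filter_upwards [ae_restrict_mem measurableSet_closedBall] with w hw t ht
      exact hC (t, w) ⟨Metric.ball_subset_closedBall ht, hw⟩
    · have : IsFiniteMeasure ((volume : Measure E3).restrict (Metric.closedBall (0 : E3) (2 * r))) :=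
        isFiniteMeasure_restrict.2 measure_closedBall_lt_top.ne
      exact integrable_const C
    · refine Eventually.of_forall fun x t _ => ?_
      have d1 : HasDerivAt (fun t : ℝ => (1 + t) • x) x t := by
        simpa using (((hasDerivAt_id t).const_add 1).smul_const x)
      have d0 : DifferentiableAt ℝ k ((1 + t) • x) := hk.differentiable (by norm_num) _
      exact (d0.hasFDerivAt.comp_hasDerivAt t d1).const_mul _
  have e1 : ∫ x in Metric.closedBall (0 : E3) (2 * r), ‖x‖ ^ b * fderiv ℝ k x x = ∫ x, ‖x‖ ^ b * fderiv ℝ k x x := by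
    refine setIntegral_eq_integral_of_forall_compl_eq_zero fun x hx => ?_
    have : fderiv ℝ k x = 0 := by
      have : k =ᶠ[𝓝 x] fun _ => 0 := by
        have ho : {y : E3 | r < ‖y‖} ∈ 𝓝 x := by
          refine (isOpen_lt continuous_const continuous_norm).mem_nhds ?_
          rw [mem_closedBall_zero_iff, not_le] at hx
          simp only [Set.mem_ofPred_eq]; linarith
        filter_upwards [ho] with y hy using hr y hy
      rw [this.fderiv_eq]; simp
    rw [this]; simp
  rw [← e1]
  refine (d2.congr_of_eventuallyEq ?_).unique d1
  filter_upwards [Metric.ball_mem_nhds (0 : ℝ) (ε := 1 / 2) (by norm_num)] with t ht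
  rw [mem_ball_zero_iff, Real.norm_eq_abs] at ht
  refine (setIntegral_eq_integral_of_forall_compl_eq_zero fun x hx => ?_).symm
  rw [out t ht x hx, mul_zero]

/-- consequence for `k = φ u^{q+1}` -/
lemma dil2 {u f φ : E3 → ℝ} (h : PP u f) {q b : ℝ} (hq : 0 < q) (hb : 0 ≤ b) (hφ : ContDiff ℝ 1 φ)
    (hc : HasCompactSupport φ) {g : E3 → ℝ} (hg : ∀ x, g x = ‖x‖ ^ b * u x ^ q) :
    (q + 1) * ∫ x, (φ x * g x) * fderiv ℝ u x x =
      -(3 + b) * (∫ x, (φ x * g x) * u x) - ∫ x, fderiv ℝ φ x x * (g x * u x) := by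
  have cb : Continuous fun x : E3 => ‖x‖ ^ b := continuous_norm.rpow_const fun x => Or.inr hb
  have cu := h.cont
  have cuq : Continuous fun x => u x ^ q := cu.rpow_const fun x => Or.inr hq.le
  have cg : Continuous g := by rw [funext hg]; fun_prop
  have cφ := hφ.continuous
  have cdφ : Continuous (fderiv ℝ φ) := hφ.continuous_fderiv (by norm_num)
  have cdu := h.cfd
  have hu1 : ContDiff ℝ 1 u := h.hu.of_le (by norm_num)
  have hk : ContDiff ℝ 1 fun x => φ x * u x ^ (q + 1) :=
    hφ.mul (hu1.rpow_const_of_ne fun x => (h.pos x).ne')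
  have key := dil hb hk hc.mul_right
  have e0 : ∀ x, ‖x‖ ^ b * (φ x * u x ^ (q + 1)) = (φ x * g x) * u x := by
    intro x
    rw [hg, Real.rpow_add_one (h.pos x).ne']; ring
  have e1 : ∀ x, ‖x‖ ^ b * fderiv ℝ (fun x => φ x * u x ^ (q + 1)) x x =
      (q + 1) * ((φ x * g x) * fderiv ℝ u x x) + fderiv ℝ φ x x * (g x * u x) := by
    intro x
    have dφ : HasFDerivAt φ (fderiv ℝ φ x) x := (hφ.differentiable (by norm_num) x).hasFDerivAt
    have du : HasFDerivAt u (fderiv ℝ u x) x := (hu1.differentiable (by norm_num) x).hasFDerivAt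
    have d := dφ.mul (du.rpow_const (p := q + 1) (Or.inl (h.pos x).ne'))
    rw [show (fun x => φ x * u x ^ (q + 1)) = φ * fun x => u x ^ (q + 1) from rfl, d.fderiv, hg]
    simp only [ContinuousLinearMap.add_apply, ContinuousLinearMap.smul_apply, smul_eq_mul,
      add_sub_cancel_right, Real.rpow_add_one (h.pos x).ne']
    ring
  simp_rw [e0, e1] at key
  rw [integral_add, integral_const_mul] at key
  · linarith
  · refine Continuous.integrable_of_hasCompactSupport (by fun_prop) ?_
    exact HasCompactSupport.mul_left (HasCompactSupport.mul_right hc.mul_right)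
  · refine Continuous.integrable_of_hasCompactSupport (by fun_prop) ?_
    refine HasCompactSupport.mul_right (hc.fderiv (𝕜 := ℝ) |>.mono ?_)
    intro x hx hx'
    simp [hx'] at hx
end HLE

namespace HLE
open Filter Topology

/-! ### Cutoff and kernel bounds -/

/-- Cutoff function at `‖x‖² = ρ` of width `τ`. -/
noncomputable def phi (ρ τ : ℝ) (x : E3) : ℝ := Real.smoothTransition ((ρ - ‖x‖ ^ 2) / τ)

/-- Weight. -/
noncomputable def mw (R τ ρ : ℝ) (y : E3) : ℝ := (‖y‖ + R) * (|‖y‖ ^ 2 - ρ| + τ)⁻¹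

lemma st_const {t : ℝ} (h : t ∉ Set.Icc (0 : ℝ) 1) : deriv Real.smoothTransition t = 0 := by
  rw [Set.mem_Icc, not_and_or, not_le, not_le] at h
  rcases h with h | h
  · have : Real.smoothTransition =ᶠ[𝓝 t] fun _ => 0 := by
      filter_upwards [gt_mem_nhds h] with s hs using Real.smoothTransition.zero_of_nonpos hs.le
    rw [this.deriv_eq]; simp
  · have : Real.smoothTransition =ᶠ[𝓝 t] fun _ => 1 := by
      filter_upwards [lt_mem_nhds h] with s hs using Real.smoothTransition.one_of_one_le hs.le
    rw [this.deriv_eq]; simp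

lemma st_diff : ContDiff ℝ 1 Real.smoothTransition := Real.smoothTransition.contDiff

lemma exists_Lc : ∃ Lc : ℝ, 0 < Lc ∧ (∀ t, |deriv Real.smoothTransition t| ≤ Lc) ∧
    ∀ s t, |Real.smoothTransition s - Real.smoothTransition t| ≤ Lc * |s - t| := by
  have cd : Continuous (deriv Real.smoothTransition) := st_diff.continuous_deriv (by norm_num)
  obtain ⟨C, hC⟩ := (isCompact_Icc (a := (0 : ℝ)) (b := 1)).exists_bound_of_continuousOn cd.continuousOn
  have h : ∀ t, |deriv Real.smoothTransition t| ≤ max C 1 := by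
    intro t
    by_cases ht : t ∈ Set.Icc (0 : ℝ) 1
    · exact (hC t ht).trans (le_max_left _ _)
    · rw [st_const ht]; simp
  refine ⟨max C 1, by positivity, h, fun s t => ?_⟩
  have := Convex.norm_image_sub_le_of_norm_deriv_le (f := Real.smoothTransition) (s := Set.univ)
    (x := t) (y := s) (fun x _ => st_diff.differentiable (by norm_num) x) (fun x _ => h x) convex_univ
    trivial trivial
  simpa using this

lemma phi_nonneg (ρ τ : ℝ) (x : E3) : 0 ≤ phi ρ τ x := Real.smoothTransition.nonneg _
lemma phi_le_one (ρ τ : ℝ) (x : E3) : phi ρ τ x ≤ 1 := Real.smoothTransition.le_one _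

lemma phi_one {ρ τ : ℝ} (hτ : 0 < τ) {x : E3} (h : ‖x‖ ^ 2 ≤ ρ - τ) : phi ρ τ x = 1 := by
  refine Real.smoothTransition.one_of_one_le ?_
  rw [le_div_iff₀ hτ]; linarith

lemma phi_zero {ρ τ : ℝ} (hτ : 0 < τ) {x : E3} (h : ρ ≤ ‖x‖ ^ 2) : phi ρ τ x = 0 := by
  refine Real.smoothTransition.zero_of_nonpos ?_
  exact div_nonpos_of_nonpos_of_nonneg (by linarith) hτ.le

lemma contDiff_phi (ρ τ : ℝ) : ContDiff ℝ 1 (phi ρ τ) := by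
  unfold phi
  exact st_diff.comp ((contDiff_const.sub (contDiff_norm_sq ℝ)).div_const τ)

lemma phi_cs {ρ τ : ℝ} (hτ : 0 < τ) : HasCompactSupport (phi ρ τ) := by
  refine HasCompactSupport.of_support_subset_isCompact (isCompact_closedBall (0 : E3) (|ρ| + 1)) ?_
  intro x hx
  rw [mem_closedBall_zero_iff]
  by_contra h
  rw [not_le] at h
  refine hx (phi_zero hτ ?_)
  have := le_abs_self ρ
  have := abs_nonneg ρ
  nlinarith

lemma phi_fderiv {ρ τ : ℝ} (x : E3) : fderiv ℝ (phi ρ τ) x x =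
    deriv Real.smoothTransition ((ρ - ‖x‖ ^ 2) / τ) * (-(2 * ‖x‖ ^ 2) / τ) := by
  have d1 : HasFDerivAt (fun x : E3 => (ρ - ‖x‖ ^ 2) / τ) (τ⁻¹ • -((2 : ℝ) • innerSL ℝ x)) x := by
    have := ((hasStrictFDerivAt_norm_sq x).hasFDerivAt.const_sub ρ).mul_const (τ⁻¹)
    rw [show ((2 : ℝ) • innerSL ℝ x) = ((2 : ℕ) • innerSL ℝ x) from by
      rw [two_smul, two_smul]]
    simpa [div_eq_mul_inv] using this
  have d2 : HasDerivAt Real.smoothTransition (deriv Real.smoothTransition ((ρ - ‖x‖ ^ 2) / τ))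
    ((ρ - ‖x‖ ^ 2) / τ) := (st_diff.differentiable (by norm_num) _).hasDerivAt
  have d3 := d2.comp_hasFDerivAt x d1
  rw [show phi ρ τ = Real.smoothTransition ∘ fun x : E3 => (ρ - ‖x‖ ^ 2) / τ from rfl, d3.fderiv]
  simp only [_root_.smul_apply, _root_.neg_apply, innerSL_apply_apply, real_inner_self_eq_norm_sq, smul_eq_mul]
  ring

/-- data of an admissible cutoff -/
structure Adm (R τ ρ : ℝ) : Prop where
  R1 : 1 ≤ R
  t0 : 0 < τ
  t1 : τ ≤ 1
  r0 : R ^ 2 ≤ ρ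
  r1 : ρ ≤ 4 * R ^ 2

lemma Adm.mw_nonneg {R τ ρ : ℝ} (h : Adm R τ ρ) (x : E3) : 0 ≤ mw R τ ρ x := by
  have := h.R1; have := h.t0; unfold mw; positivity

lemma phi_fderiv_bd {R τ ρ : ℝ} (h : Adm R τ ρ) {Lc : ℝ}
    (hL : ∀ t, |deriv Real.smoothTransition t| ≤ Lc) (x : E3) :
    |fderiv ℝ (phi ρ τ) x x| ≤ 8 * Lc * R * mw R τ ρ x := by
  have hR := h.R1
  have hτ := h.t0
  have hr1 := h.r1
  have hL0 : 0 ≤ Lc := (abs_nonneg _).trans (hL 0)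
  rw [phi_fderiv]
  by_cases ht : (ρ - ‖x‖ ^ 2) / τ ∈ Set.Icc (0 : ℝ) 1
  · rw [abs_mul]
    refine (mul_le_mul_of_nonneg_right (hL _) (abs_nonneg _)).trans ?_
    rw [Set.mem_Icc, le_div_iff₀ hτ, div_le_iff₀ hτ] at ht
    have n2 : ‖x‖ ≤ 2 * R := by
      have := norm_nonneg x
      nlinarith
    have e : |-(2 * ‖x‖ ^ 2) / τ| = 2 * ‖x‖ ^ 2 * τ⁻¹ := by
      rw [abs_div, abs_neg, abs_of_nonneg (by positivity), abs_of_pos hτ, div_eq_mul_inv]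
    rw [e]
    have m1 : (‖x‖ + R) * (2 * τ)⁻¹ ≤ mw R τ ρ x := by
      unfold mw
      have : |‖x‖ ^ 2 - ρ| + τ ≤ 2 * τ := by
        have : |‖x‖ ^ 2 - ρ| ≤ τ := by rw [abs_le]; constructor <;> linarith
        linarith
      gcongr
    calc Lc * (2 * ‖x‖ ^ 2 * τ⁻¹) = Lc * (4 * ‖x‖ * (‖x‖ * (2 * τ)⁻¹)) := by field_simp; ring
      _ ≤ Lc * (4 * (2 * R) * ((‖x‖ + R) * (2 * τ)⁻¹)) := by gcongr; linarith
      _ ≤ Lc * (4 * (2 * R) * mw R τ ρ x) := by gcongr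
      _ = _ := by ring
  · rw [st_const ht, zero_mul, abs_zero]
    have := h.mw_nonneg x
    positivity

lemma phi_fderiv_zero {R τ ρ : ℝ} (h : Adm R τ ρ) {x : E3}
    (hx : fderiv ℝ (phi ρ τ) x x ≠ 0) : ‖x‖ ≤ 2 * R ∧ |‖x‖ ^ 2 - ρ| ≤ τ := by
  have hR := h.R1
  have hτ := h.t0
  have hr1 := h.r1
  rw [phi_fderiv] at hx
  by_cases ht : (ρ - ‖x‖ ^ 2) / τ ∈ Set.Icc (0 : ℝ) 1
  · rw [Set.mem_Icc, le_div_iff₀ hτ, div_le_iff₀ hτ] at ht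
    have := norm_nonneg x
    refine ⟨by nlinarith, by rw [abs_le]; constructor <;> linarith⟩
  · rw [st_const ht] at hx; simp at hx

lemma diff_sq (x y : E3) : |‖x‖ ^ 2 - ‖y‖ ^ 2| ≤ ‖x - y‖ * (‖x‖ + ‖y‖) := by
  have e : ‖x‖ ^ 2 - ‖y‖ ^ 2 = (‖x‖ - ‖y‖) * (‖x‖ + ‖y‖) := by ring
  rw [e, abs_mul, abs_of_nonneg (a := ‖x‖ + ‖y‖) (by positivity)]
  gcongr
  exact abs_norm_sub_norm_le x y

/-- near part -/
noncomputable def nu (σ : ℝ) (z : E3) : ℝ := Set.indicator (Metric.ball (0 : E3) σ) (fun z => ‖z‖⁻¹) z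

lemma nu_nonneg (σ : ℝ) (z : E3) : 0 ≤ nu σ z := by
  unfold nu; exact Set.indicator_nonneg (fun z _ => by positivity) z

lemma shell_bd {R τ ρ : ℝ} (h : Adm R τ ρ) {x y : E3} (hx : ‖x‖ ≤ 2 * R) (hs : |‖x‖ ^ 2 - ρ| ≤ τ) :
    ‖x - y‖⁻¹ ≤ 18 * mw R τ ρ y + Set.indicator (Metric.closedBall (0 : E3) (3 * R)) 1 y *
      nu (τ / (8 * R)) (x - y) := by
  have hR := h.R1
  have hτ := h.t0
  have hτ1 := h.t1
  have ny := norm_nonneg y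
  rcases le_or_gt (τ / (8 * R)) ‖x - y‖ with hd | hd
  · have d0 : 0 < ‖x - y‖ := lt_of_lt_of_le (by positivity) hd
    rw [div_le_iff₀ (by positivity)] at hd
    have n0 := nu_nonneg (τ / (8 * R)) (x - y)
    have i0 : 0 ≤ Set.indicator (Metric.closedBall (0 : E3) (3 * R)) (1 : E3 → ℝ) y :=
      Set.indicator_nonneg (fun _ _ => zero_le_one) _
    have : ‖x - y‖⁻¹ ≤ 18 * mw R τ ρ y := by
      unfold mw
      have hD : |‖y‖ ^ 2 - ρ| + τ ≤ ‖x - y‖ * (18 * (‖y‖ + R)) := by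
        have h1 := diff_sq x y
        have h2 : |‖y‖ ^ 2 - ρ| ≤ |‖x‖ ^ 2 - ‖y‖ ^ 2| + |‖x‖ ^ 2 - ρ| := by
          have := abs_sub_abs_le_abs_sub (‖y‖ ^ 2 - ρ) (‖x‖ ^ 2 - ρ)
          rw [sub_sub_sub_cancel_right, abs_sub_comm (‖y‖ ^ 2) (‖x‖ ^ 2)] at this
          linarith
        nlinarith
      rw [inv_le_iff_one_le_mul₀ d0]
      have hp : 0 < |‖y‖ ^ 2 - ρ| + τ := by positivity
      calc 1 = (|‖y‖ ^ 2 - ρ| + τ) * (|‖y‖ ^ 2 - ρ| + τ)⁻¹ := by field_simp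
        _ ≤ ‖x - y‖ * (18 * (‖y‖ + R)) * (|‖y‖ ^ 2 - ρ| + τ)⁻¹ := by gcongr
        _ = _ := by ring
    nlinarith [mul_nonneg i0 n0]
  · have hσ : τ / (8 * R) ≤ R := by
      rw [div_le_iff₀ (by positivity)]; nlinarith
    have hy : ‖y‖ ≤ 3 * R := by
      have := norm_sub_norm_le y x; rw [norm_sub_rev] at this; linarith
    rw [Set.indicator_of_mem (mem_closedBall_zero_iff.2 hy), nu,
      Set.indicator_of_mem (mem_ball_zero_iff.2 hd)]
    have := h.mw_nonneg y
    simp only [Pi.one_apply, one_mul]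
    linarith

set_option maxHeartbeats 1000000 in
lemma Kn_bd_aux {R τ ρ : ℝ} (h : Adm R τ ρ) {Lc : ℝ} (hL0 : 0 ≤ Lc)
    (hL : ∀ s t, |Real.smoothTransition s - Real.smoothTransition t| ≤ Lc * |s - t|) {x y : E3}
    (hxy : ‖x‖ ≤ ‖y‖) :
    Kn (phi ρ τ) x y ≤ 3000 * R * mw R τ ρ x * mw R τ ρ y + 36 * Lc * R ^ 2 * τ⁻¹ *
      (Set.indicator (Metric.closedBall (0 : E3) (3 * R)) 1 x *
      Set.indicator (Metric.closedBall (0 : E3) (3 * R)) 1 y * nu (τ / (8 * R)) (x - y)) := by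
  have hR := h.R1
  have hτ := h.t0
  have hτ1 := h.t1
  have hr0 := h.r0
  have hr1 := h.r1
  have nx := norm_nonneg x
  have ny := norm_nonneg y
  have i0 : ∀ y, 0 ≤ Set.indicator (Metric.closedBall (0 : E3) (3 * R)) (1 : E3 → ℝ) y := fun y =>
    Set.indicator_nonneg (fun _ _ => zero_le_one) _
  have n0 := nu_nonneg (τ / (8 * R)) (x - y)
  have mx := h.mw_nonneg x
  have my := h.mw_nonneg y
  have T2 : 0 ≤ 36 * Lc * R ^ 2 * τ⁻¹ *
      (Set.indicator (Metric.closedBall (0 : E3) (3 * R)) 1 x *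
      Set.indicator (Metric.closedBall (0 : E3) (3 * R)) 1 y * nu (τ / (8 * R)) (x - y)) := by
    have := i0 x; have := i0 y
    positivity
  have T1 : 0 ≤ 3000 * R * mw R τ ρ x * mw R τ ρ y := by positivity
  have sq : ‖x‖ ^ 2 ≤ ‖y‖ ^ 2 := by gcongr
  by_cases hne : phi ρ τ x = phi ρ τ y
  · have : Kn (phi ρ τ) x y = 0 := by unfold Kn; rw [hne]; simp
    rw [this]; linarith
  have c1 : ‖x‖ ^ 2 < ρ := by
    by_contra hc
    rw [not_lt] at hc
    exact hne (by rw [phi_zero hτ hc, phi_zero hτ (hc.trans sq)])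
  have c2 : ρ - τ < ‖y‖ ^ 2 := by
    by_contra hc
    rw [not_lt] at hc
    exact hne (by rw [phi_one hτ hc, phi_one hτ (sq.trans hc)])
  have x2 : ‖x‖ ≤ 2 * R := by nlinarith
  have d0 : 0 < ‖x - y‖ := by
    rw [norm_pos_iff, sub_ne_zero]
    rintro rfl; exact hne rfl
  have ds := diff_sq x y
  rw [abs_of_nonpos (by linarith)] at ds
  rcases le_or_gt (τ / (8 * R)) ‖x - y‖ with hd | hd
  · refine le_trans ?_ (le_add_of_nonneg_right T2)
    rw [div_le_iff₀ (by positivity)] at hd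
    have K1 : Kn (phi ρ τ) x y ≤ (‖x‖ + ‖y‖) * (‖x - y‖ ^ 2)⁻¹ := by
      unfold Kn
      refine mul_le_of_le_one_left (by positivity) ?_
      have a1 := phi_nonneg ρ τ x
      have a2 := phi_nonneg ρ τ y
      have a3 := phi_le_one ρ τ x
      have a4 := phi_le_one ρ τ y
      rw [abs_le]; constructor <;> linarith
    refine K1.trans ?_
    have px : 0 < |‖x‖ ^ 2 - ρ| + τ := by positivity
    have py : 0 < |‖y‖ ^ 2 - ρ| + τ := by positivity
    rcases le_or_gt ‖y‖ (4 * R) with y4 | y4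
    · have mx1 : (22 * ‖x - y‖)⁻¹ ≤ mw R τ ρ x := by
        have : |‖x‖ ^ 2 - ρ| + τ ≤ 22 * R * ‖x - y‖ := by
          have : |‖x‖ ^ 2 - ρ| ≤ ‖y‖ ^ 2 - ‖x‖ ^ 2 + τ := by
            rw [abs_le]; constructor <;> linarith
          nlinarith
        unfold mw
        calc (22 * ‖x - y‖)⁻¹ = (0 + R) * (22 * R * ‖x - y‖)⁻¹ := by field_simp; ring
          _ ≤ _ := by gcongr
      have my1 : (22 * ‖x - y‖)⁻¹ ≤ mw R τ ρ y := by
        have : |‖y‖ ^ 2 - ρ| + τ ≤ 22 * R * ‖x - y‖ := by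
          have : |‖y‖ ^ 2 - ρ| ≤ ‖y‖ ^ 2 - ‖x‖ ^ 2 + τ := by
            rw [abs_le]; constructor <;> linarith
          nlinarith
        unfold mw
        calc (22 * ‖x - y‖)⁻¹ = (0 + R) * (22 * R * ‖x - y‖)⁻¹ := by field_simp; ring
          _ ≤ _ := by gcongr
      calc (‖x‖ + ‖y‖) * (‖x - y‖ ^ 2)⁻¹ ≤ (2 * R + 4 * R) * (‖x - y‖ ^ 2)⁻¹ := by gcongr
        _ = 2904 * R * (22 * ‖x - y‖)⁻¹ * (22 * ‖x - y‖)⁻¹ := by field_simp; ring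
        _ ≤ 3000 * R * (22 * ‖x - y‖)⁻¹ * (22 * ‖x - y‖)⁻¹ := by gcongr; norm_num
        _ ≤ _ := by gcongr
    · have y0 : 0 < ‖y‖ := by linarith
      have mx1 : (5 * R)⁻¹ ≤ mw R τ ρ x := by
        have : |‖x‖ ^ 2 - ρ| + τ ≤ 5 * R ^ 2 := by
          have : |‖x‖ ^ 2 - ρ| ≤ 4 * R ^ 2 := by
            rw [abs_le]; constructor <;> nlinarith
          nlinarith
        unfold mw
        calc (5 * R)⁻¹ = (0 + R) * (5 * R ^ 2)⁻¹ := by field_simp; ring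
          _ ≤ _ := by gcongr
      have my1 : (‖y‖)⁻¹ ≤ mw R τ ρ y := by
        have : |‖y‖ ^ 2 - ρ| + τ ≤ ‖y‖ ^ 2 := by
          rw [abs_of_nonneg (by nlinarith)]
          nlinarith
        unfold mw
        calc (‖y‖)⁻¹ = (‖y‖ + 0) * (‖y‖ ^ 2)⁻¹ := by field_simp; ring
          _ ≤ _ := by gcongr; linarith
      have hdy : ‖y‖ / 2 ≤ ‖x - y‖ := by
        have := norm_sub_norm_le y x; rw [norm_sub_rev] at this; linarith
      calc (‖x‖ + ‖y‖) * (‖x - y‖ ^ 2)⁻¹ ≤ (‖y‖ + ‖y‖) * ((‖y‖ / 2) ^ 2)⁻¹ := by gcongr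
        _ = 40 * R * (5 * R)⁻¹ * (‖y‖)⁻¹ := by field_simp; ring
        _ ≤ 3000 * R * (5 * R)⁻¹ * (‖y‖)⁻¹ := by gcongr; norm_num
        _ ≤ _ := by gcongr
  · refine le_trans ?_ (le_add_of_nonneg_left T1)
    have hσ : τ / (8 * R) ≤ R := by
      rw [div_le_iff₀ (by positivity)]; nlinarith
    have hy : ‖y‖ ≤ 3 * R := by
      have := norm_sub_norm_le y x; rw [norm_sub_rev] at this; linarith
    rw [Set.indicator_of_mem (mem_closedBall_zero_iff.2 hy),
      Set.indicator_of_mem (mem_closedBall_zero_iff.2 (hxy.trans hy)), nu,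
      Set.indicator_of_mem (mem_ball_zero_iff.2 hd)]
    simp only [Pi.one_apply, one_mul]
    have l1 : |phi ρ τ x - phi ρ τ y| ≤ Lc * ((‖x - y‖ * (6 * R)) * τ⁻¹) := by
      refine (hL _ _).trans ?_
      have : |(ρ - ‖x‖ ^ 2) / τ - (ρ - ‖y‖ ^ 2) / τ| = (‖y‖ ^ 2 - ‖x‖ ^ 2) * τ⁻¹ := by
        rw [← sub_div, sub_sub_sub_cancel_left, abs_of_nonneg (div_nonneg (by linarith) hτ.le),
          div_eq_mul_inv]
      rw [this]
      gcongr
      refine (le_trans (by linarith) ds).trans ?_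
      gcongr; linarith
    unfold Kn
    calc _ ≤ Lc * ((‖x - y‖ * (6 * R)) * τ⁻¹) * ((3 * R + 3 * R) * (‖x - y‖ ^ 2)⁻¹) := by
          gcongr; linarith
      _ = _ := by field_simp; ring

lemma Kn_bd {R τ ρ : ℝ} (h : Adm R τ ρ) {Lc : ℝ} (hL0 : 0 ≤ Lc)
    (hL : ∀ s t, |Real.smoothTransition s - Real.smoothTransition t| ≤ Lc * |s - t|) (x y : E3) :
    Kn (phi ρ τ) x y ≤ 3000 * R * mw R τ ρ x * mw R τ ρ y + 36 * Lc * R ^ 2 * τ⁻¹ *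
      (Set.indicator (Metric.closedBall (0 : E3) (3 * R)) 1 x *
      Set.indicator (Metric.closedBall (0 : E3) (3 * R)) 1 y * nu (τ / (8 * R)) (x - y)) := by
  rcases le_total ‖x‖ ‖y‖ with hxy | hxy
  · exact Kn_bd_aux h hL0 hL hxy
  · have := Kn_bd_aux h hL0 hL hxy
    rw [Kn_symm]
    have e : nu (τ / (8 * R)) (y - x) = nu (τ / (8 * R)) (x - y) := by
      unfold nu
      simp only [Set.indicator, mem_ball_zero_iff, norm_sub_rev y x]
    rw [e] at this
    refine this.trans (le_of_eq ?_)
    ring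
end HLE

namespace HLE
open Filter Topology

/-! ### Estimates of the error terms -/

lemma nu_even (σ : ℝ) (x y : E3) : nu σ (x - y) = nu σ (y - x) := by
  unfold nu
  simp only [Set.indicator, mem_ball_zero_iff, norm_sub_rev y x]

lemma nu_integrable (σ : ℝ) : Integrable (nu σ) := by
  have e : nu σ = fun z : E3 => Set.indicator (Set.Iio σ) (fun r => r⁻¹) ‖z‖ := by
    ext z; unfold nu; simp only [Set.indicator, mem_ball_zero_iff, Set.mem_Iio]
  rw [e, integrable_fun_norm_addHaar]
  simp only [finrank_euclideanSpace, Fintype.card_fin, smul_eq_mul]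
  have e2 : ∀ y ∈ Set.Ioi (0 : ℝ), y ^ (3 - 1) * Set.indicator (Set.Iio σ) (fun r => r⁻¹) y =
      Set.indicator (Set.Iio σ) (fun r => r) y := by
    intro y hy
    have : (y : ℝ) ≠ 0 := (ne_of_gt hy)
    simp only [Set.indicator]
    split_ifs
    · field_simp
    · simp
  rw [integrableOn_congr_fun e2 measurableSet_Ioi, IntegrableOn, integrable_indicator_iff measurableSet_Iio,
    IntegrableOn, Measure.restrict_restrict measurableSet_Iio]
  refine IntegrableOn.mono_set (t := Set.Icc 0 σ) (continuous_id.integrableOn_Icc) ?_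
  intro y hy
  exact ⟨le_of_lt hy.2, le_of_lt hy.1⟩

/-- the constant `∫ nu 1` -/
noncomputable def N1 : ℝ := ∫ z, nu 1 z

lemma N1_nonneg : 0 ≤ N1 := integral_nonneg (nu_nonneg 1)

lemma nu_integral {σ : ℝ} (hσ : 0 < σ) : ∫ z, nu σ z = σ ^ 2 * N1 := by
  have e : ∀ w : E3, nu σ (σ • w) = σ⁻¹ * nu 1 w := by
    intro w
    unfold nu
    have hm : σ • w ∈ Metric.ball (0 : E3) σ ↔ w ∈ Metric.ball (0 : E3) 1 := by
      rw [mem_ball_zero_iff, mem_ball_zero_iff, norm_smul, Real.norm_eq_abs, abs_of_pos hσ]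
      constructor
      · intro h; exact (mul_lt_iff_lt_one_right hσ).1 h
      · intro h; exact (mul_lt_iff_lt_one_right hσ).2 h
    by_cases h : w ∈ Metric.ball (0 : E3) 1
    · rw [Set.indicator_of_mem h, Set.indicator_of_mem (hm.2 h), norm_smul, Real.norm_eq_abs,
        abs_of_pos hσ, mul_inv]
    · rw [Set.indicator_of_notMem h, Set.indicator_of_notMem (fun h' => h (hm.1 h')), mul_zero]
  have h1 := Measure.integral_comp_smul volume (nu σ) σ
  simp_rw [e] at h1
  rw [integral_const_mul] at h1
  simp only [finrank_euclideanSpace, Fintype.card_fin, smul_eq_mul] at h1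
  rw [abs_of_pos (by positivity)] at h1
  unfold N1
  field_simp at h1
  linarith

lemma nu_shift {σ : ℝ} (hσ : 0 < σ) (x : E3) : ∫ y, nu σ (x - y) = σ ^ 2 * N1 := by
  rw [integral_sub_left_eq_self (fun y => nu σ y), nu_integral hσ]

lemma Adm.mw_le {R τ ρ : ℝ} (h : Adm R τ ρ) (y : E3) :
    mw R τ ρ y ≤ (25 * R ^ 2 * τ⁻¹ + 10) * (R + ‖y‖)⁻¹ := by
  have hR := h.R1
  have hτ := h.t0
  have hr1 := h.r1
  have ny := norm_nonneg y
  have pos : 0 < R + ‖y‖ := by linarith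
  rw [le_mul_inv_iff₀ pos]
  unfold mw
  rcases le_or_gt ‖y‖ (4 * R) with y4 | y4
  · have h1 : (|‖y‖ ^ 2 - ρ| + τ)⁻¹ ≤ τ⁻¹ := by
      gcongr; have := abs_nonneg (‖y‖ ^ 2 - ρ); linarith
    calc _ ≤ (4 * R + R) * τ⁻¹ * (R + 4 * R) := by gcongr
      _ ≤ _ := by nlinarith
  · have h1 : (R + ‖y‖) ^ 2 / 10 ≤ |‖y‖ ^ 2 - ρ| + τ := by
      have := le_abs_self (‖y‖ ^ 2 - ρ)
      nlinarith
    have h2 : 0 < |‖y‖ ^ 2 - ρ| + τ := by positivity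
    have h3 : 0 ≤ 25 * R ^ 2 * τ⁻¹ := by positivity
    have h4 : (‖y‖ + R) * (|‖y‖ ^ 2 - ρ| + τ)⁻¹ * (R + ‖y‖) = (R + ‖y‖) ^ 2 / (|‖y‖ ^ 2 - ρ| + τ) := by
      field_simp; ring
    rw [h4]
    have : (R + ‖y‖) ^ 2 / (|‖y‖ ^ 2 - ρ| + τ) ≤ 10 := by
      rw [div_le_iff₀ h2]; linarith
    linarith

lemma Adm.mw_cont {R τ ρ : ℝ} (h : Adm R τ ρ) : Continuous (mw R τ ρ) := by
  unfold mw
  refine Continuous.mul (by fun_prop) (Continuous.inv₀ (by fun_prop) fun y => ?_)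
  have := h.t0; positivity

lemma Adm.mw_int {R τ ρ : ℝ} (h : Adm R τ ρ) {u f : E3 → ℝ} (hu : PP u f) :
    Integrable fun y => f y * mw R τ ρ y := by
  have hR : 0 < R := by have := h.R1; linarith
  refine ((hu.A_integrable hR).const_mul (25 * R ^ 2 * τ⁻¹ + 10)).mono'
    (hu.hf.mul h.mw_cont).aestronglyMeasurable (Eventually.of_forall fun y => ?_)
  rw [Real.norm_eq_abs, abs_of_nonneg (mul_nonneg (hu.hf0 y) (h.mw_nonneg y))]
  calc f y * mw R τ ρ y ≤ f y * ((25 * R ^ 2 * τ⁻¹ + 10) * (R + ‖y‖)⁻¹) :=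
        mul_le_mul_of_nonneg_left (h.mw_le y) (hu.hf0 y)
    _ = _ := by ring

/-- `Ψ` -/
noncomputable def Psi (f : E3 → ℝ) (R τ ρ : ℝ) : ℝ := ∫ y, f y * mw R τ ρ y

lemma Psi_nonneg {R τ ρ : ℝ} (h : Adm R τ ρ) {u f : E3 → ℝ} (hu : PP u f) : 0 ≤ Psi f R τ ρ :=
  integral_nonneg fun y => mul_nonneg (hu.hf0 y) (h.mw_nonneg y)

lemma near_int {u f v g : E3 → ℝ} (hu : PP u f) (hv : PP v g) {R F σ : ℝ} (hR : 0 < R) (hσ : 0 < σ)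
    (hF0 : 0 ≤ F) (hF : ∀ y ∈ Metric.closedBall (0 : E3) (3 * R), f y ≤ F) :
    Integrable (fun z : E3 × E3 => g z.1 * f z.2 *
      (Set.indicator (Metric.closedBall (0 : E3) (3 * R)) 1 z.1 *
      Set.indicator (Metric.closedBall (0 : E3) (3 * R)) 1 z.2 * nu σ (z.1 - z.2))) (volume.prod volume) ∧
    ∫ z : E3 × E3, g z.1 * f z.2 *
      (Set.indicator (Metric.closedBall (0 : E3) (3 * R)) 1 z.1 *
      Set.indicator (Metric.closedBall (0 : E3) (3 * R)) 1 z.2 * nu σ (z.1 - z.2)) ∂(volume.prod volume)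
      ≤ F * (σ ^ 2 * N1) * (4 * R * A g R) := by
  set B := Metric.closedBall (0 : E3) (3 * R) with hB
  have mB : MeasurableSet B := measurableSet_closedBall
  have ig : Integrable (B.indicator g) := by
    rw [integrable_indicator_iff mB]
    exact hv.hf.continuousOn.integrableOn_compact (isCompact_closedBall _ _)
  have mnu : Measurable (nu σ) := by
    unfold nu
    exact Measurable.indicator (by fun_prop) measurableSet_ball
  have i1 := (ig.convolution_integrand (ContinuousLinearMap.mul ℝ ℝ) (nu_integrable σ)).swap
  have i2 : Integrable (fun z : E3 × E3 => B.indicator g z.1 * (F * nu σ (z.1 - z.2))) (volume.prod volume) := by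
    convert i1.const_mul F using 1
    ext z
    simp only [Function.comp, ContinuousLinearMap.mul_apply', Prod.fst_swap, Prod.snd_swap]
    rw [nu_even σ z.2 z.1]
    ring
  have le : ∀ z : E3 × E3, g z.1 * f z.2 * (B.indicator 1 z.1 * B.indicator 1 z.2 * nu σ (z.1 - z.2)) ≤
      B.indicator g z.1 * (F * nu σ (z.1 - z.2)) := by
    intro z
    have n0 := nu_nonneg σ (z.1 - z.2)
    have g0 := hv.hf0 z.1
    by_cases h1 : z.1 ∈ B
    · by_cases h2 : z.2 ∈ B
      · simp only [Set.indicator_of_mem h1, Set.indicator_of_mem h2, Pi.one_apply, one_mul]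
        rw [mul_assoc]
        have := hF _ h2
        gcongr
      · simp only [Set.indicator_of_mem h1, Set.indicator_of_notMem h2, mul_zero, zero_mul]
        positivity
    · simp only [Set.indicator_of_notMem h1, mul_zero, zero_mul, le_refl]
  have nn : ∀ z : E3 × E3, 0 ≤ g z.1 * f z.2 * (B.indicator 1 z.1 * B.indicator 1 z.2 * nu σ (z.1 - z.2)) := by
    intro z
    have n0 := nu_nonneg σ (z.1 - z.2)
    have g0 := hv.hf0 z.1
    have f0 := hu.hf0 z.2
    have i0 : ∀ y, 0 ≤ B.indicator (1 : E3 → ℝ) y := fun y =>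
      Set.indicator_nonneg (fun _ _ => zero_le_one) _
    have := i0 z.1; have := i0 z.2
    positivity
  have i3 : Integrable (fun z : E3 × E3 => g z.1 * f z.2 *
      (B.indicator 1 z.1 * B.indicator 1 z.2 * nu σ (z.1 - z.2))) (volume.prod volume) := by
    refine i2.mono' ?_ (Eventually.of_forall fun z => ?_)
    · have m1 := hv.hf.measurable
      have m2 := hu.hf.measurable
      have m3 : Measurable (B.indicator (1 : E3 → ℝ)) := measurable_one.indicator mB
      exact Measurable.aestronglyMeasurable (by fun_prop)
    · rw [Real.norm_eq_abs, abs_of_nonneg (nn z)]; exact le z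
  refine ⟨i3, (integral_mono i3 i2 le).trans ?_⟩
  rw [integral_prod _ i2]
  simp only [integral_const_mul, nu_shift hσ]
  rw [integral_mul_const, integral_indicator mB, mul_comm]
  have := hv.mass_le hR (r := 3 * R) (by positivity)
  have n1 := N1_nonneg
  refine mul_le_mul_of_nonneg_left (this.trans (le_of_eq (by ring))) (by positivity)

section
variable {u f v g : E3 → ℝ} {R τ ρ Lc F : ℝ}

lemma E_bd (hu : PP u f) (hv : PP v g) (h : Adm R τ ρ) (hL0 : 0 ≤ Lc)
    (hL : ∀ s t, |Real.smoothTransition s - Real.smoothTransition t| ≤ Lc * |s - t|)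
    (hF0 : 0 ≤ F) (hF : ∀ y ∈ Metric.closedBall (0 : E3) (3 * R), f y ≤ F) :
    Integrable (fun z : E3 × E3 => g z.1 * f z.2 * Kn (phi ρ τ) z.1 z.2) (volume.prod volume) ∧
    ∫ z : E3 × E3, g z.1 * f z.2 * Kn (phi ρ τ) z.1 z.2 ∂(volume.prod volume) ≤
      3000 * R * (Psi g R τ ρ * Psi f R τ ρ) +
      36 * Lc * R ^ 2 * τ⁻¹ * (F * ((τ / (8 * R)) ^ 2 * N1) * (4 * R * A g R)) := by
  have hR : 0 < R := by have := h.R1; linarith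
  have hτ := h.t0
  obtain ⟨i1, n1⟩ := near_int hu hv (σ := τ / (8 * R)) hR (by positivity) hF0 hF
  have i2 := ((h.mw_int hv).mul_prod (h.mw_int hu)).const_mul (3000 * R)
  have i3 := i1.const_mul (36 * Lc * R ^ 2 * τ⁻¹)
  have le : ∀ z : E3 × E3, g z.1 * f z.2 * Kn (phi ρ τ) z.1 z.2 ≤
      3000 * R * (g z.1 * mw R τ ρ z.1 * (f z.2 * mw R τ ρ z.2)) + 36 * Lc * R ^ 2 * τ⁻¹ *
      (g z.1 * f z.2 * (Set.indicator (Metric.closedBall (0 : E3) (3 * R)) 1 z.1 *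
      Set.indicator (Metric.closedBall (0 : E3) (3 * R)) 1 z.2 * nu (τ / (8 * R)) (z.1 - z.2))) := by
    intro z
    have := mul_le_mul_of_nonneg_left (Kn_bd h hL0 hL z.1 z.2) (mul_nonneg (hv.hf0 z.1) (hu.hf0 z.2))
    refine this.trans (le_of_eq ?_)
    ring
  have iE : Integrable (fun z : E3 × E3 => g z.1 * f z.2 * Kn (phi ρ τ) z.1 z.2) (volume.prod volume) := by
    refine (i2.add i3).mono' ?_ (Eventually.of_forall fun z => ?_)
    · have m1 := hv.hf.measurable
      have m2 := hu.hf.measurable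
      have m3 := (contDiff_phi ρ τ).continuous.measurable
      unfold Kn
      exact Measurable.aestronglyMeasurable (by fun_prop)
    · rw [Real.norm_eq_abs, abs_of_nonneg
        (mul_nonneg (mul_nonneg (hv.hf0 z.1) (hu.hf0 z.2)) (Kn_nonneg _ _ _))]
      exact le z
  refine ⟨iE, (integral_mono iE (i2.add i3) le).trans ?_⟩
  refine (le_of_eq (integral_add i2 i3)).trans ?_
  rw [integral_const_mul, integral_const_mul,
    integral_prod_mul (fun x => g x * mw R τ ρ x) (fun x => f x * mw R τ ρ x)]
  unfold Psi
  gcongr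

lemma shell_u (hu : PP u f) (Vu : Van u) (h : Adm R τ ρ)
    (hF : ∀ y ∈ Metric.closedBall (0 : E3) (3 * R), f y ≤ F) (hF0 : 0 ≤ F) {x : E3}
    (hx : ‖x‖ ≤ 2 * R) (hs : |‖x‖ ^ 2 - ρ| ≤ τ) :
    c0 * u x ≤ 18 * Psi f R τ ρ + F * ((τ / (8 * R)) ^ 2 * N1) := by
  have hR : 0 < R := by have := h.R1; linarith
  have hτ := h.t0
  have hσ : 0 < τ / (8 * R) := by positivity
  have i1 := (h.mw_int hu).const_mul 18
  have i2 : Integrable fun y => F * nu (τ / (8 * R)) (x - y) :=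
    ((nu_integrable (τ / (8 * R))).comp_sub_left x).const_mul F
  rw [hu.upper Vu x, ← nu_shift hσ x, ← integral_const_mul, Psi, ← integral_const_mul,
    ← integral_add i1 i2]
  refine integral_mono (hu.integrable x) (i1.add i2) fun y => ?_
  have h1 := mul_le_mul_of_nonneg_left (shell_bd h (y := y) hx hs) (hu.hf0 y)
  refine h1.trans ?_
  rw [mul_add]
  have n0 := nu_nonneg (τ / (8 * R)) (x - y)
  have : f y * (Set.indicator (Metric.closedBall (0 : E3) (3 * R)) 1 y * nu (τ / (8 * R)) (x - y)) ≤
      F * nu (τ / (8 * R)) (x - y) := by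
    by_cases hy : y ∈ Metric.closedBall (0 : E3) (3 * R)
    · rw [Set.indicator_of_mem hy, Pi.one_apply, one_mul]
      exact mul_le_mul_of_nonneg_right (hF y hy) n0
    · rw [Set.indicator_of_notMem hy, zero_mul, mul_zero]; positivity
  have e : f y * (18 * mw R τ ρ y) = 18 * (f y * mw R τ ρ y) := by ring
  linarith

lemma bdry (hu : PP u f) (hv : PP v g) (Vu : Van u) (h : Adm R τ ρ)
    (hL : ∀ t, |deriv Real.smoothTransition t| ≤ Lc)
    (hF : ∀ y ∈ Metric.closedBall (0 : E3) (3 * R), f y ≤ F) (hF0 : 0 ≤ F) :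
    c0 * |∫ x, fderiv ℝ (phi ρ τ) x x * (g x * u x)| ≤
      8 * Lc * R * Psi g R τ ρ * (18 * Psi f R τ ρ + F * ((τ / (8 * R)) ^ 2 * N1)) := by
  have hR : 0 < R := by have := h.R1; linarith
  have hτ := h.t0
  have hL0 : 0 ≤ Lc := (abs_nonneg _).trans (hL 0)
  set S := 18 * Psi f R τ ρ + F * ((τ / (8 * R)) ^ 2 * N1) with hS
  have S0 : 0 ≤ S := by
    have := Psi_nonneg h hu; have := N1_nonneg; positivity
  have i1 := (h.mw_int hv).const_mul (8 * Lc * R * S)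
  have key : ‖∫ x, c0 * (fderiv ℝ (phi ρ τ) x x * (g x * u x))‖ ≤
      ∫ x, 8 * Lc * R * S * (g x * mw R τ ρ x) := by
    refine norm_integral_le_of_norm_le i1 (Eventually.of_forall fun x => ?_)
    have g0 := hv.hf0 x
    have m0 := h.mw_nonneg x
    have u0 := (hu.pos x).le
    rw [Real.norm_eq_abs, abs_mul, abs_mul, abs_of_pos c0_pos, abs_of_nonneg (mul_nonneg g0 u0)]
    by_cases hx : fderiv ℝ (phi ρ τ) x x = 0
    · rw [hx, abs_zero, zero_mul, mul_zero]; positivity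
    · obtain ⟨a1, a2⟩ := phi_fderiv_zero h hx
      have h1 := shell_u hu Vu h hF hF0 a1 a2
      have h2 := phi_fderiv_bd h hL x
      have c := c0_pos
      calc c0 * (|fderiv ℝ (phi ρ τ) x x| * (g x * u x)) =
          |fderiv ℝ (phi ρ τ) x x| * (g x * (c0 * u x)) := by ring
        _ ≤ (8 * Lc * R * mw R τ ρ x) * (g x * S) := by gcongr
        _ = _ := by ring
  rw [integral_const_mul, integral_const_mul, Real.norm_eq_abs, abs_mul, abs_of_pos c0_pos] at key
  refine key.trans (le_of_eq ?_)
  unfold Psi; ring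
end
end HLE

namespace HLE
open Filter Topology

/-! ### Choice of a good radius -/

lemma oned {s L τ A B : ℝ} (hτ : 0 < τ) (hL : 0 < L) (hA : s - L ≤ A) (hB : B ≤ s + L) :
    ∫ ρ in Set.Icc A B, (|s - ρ| + τ)⁻¹ ≤ 2 * Real.log (1 + L / τ) := by
  have cont : Continuous fun w : ℝ => (|w| + τ)⁻¹ :=
    Continuous.inv₀ (by fun_prop) fun w => by positivity
  have cont2 : Continuous fun ρ : ℝ => (|s - ρ| + τ)⁻¹ := cont.comp (continuous_const.sub continuous_id)
  have h1 : ∫ ρ in Set.Icc A B, (|s - ρ| + τ)⁻¹ ≤ ∫ ρ in Set.Icc (s - L) (s + L), (|s - ρ| + τ)⁻¹ := by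
    refine setIntegral_mono_set cont2.integrableOn_Icc (Eventually.of_forall fun ρ => ?_)
      (Set.Icc_subset_Icc hA hB).eventuallyLE
    simp only [Pi.zero_apply]; positivity
  refine h1.trans (le_of_eq ?_)
  rw [integral_Icc_eq_integral_Ioc, ← intervalIntegral.integral_of_le (by linarith),
    intervalIntegral.integral_comp_sub_left (fun w => (|w| + τ)⁻¹) s]
  have e1 : s - (s + L) = -L := by ring
  have e2 : s - (s - L) = L := by ring
  rw [e1, e2, ← intervalIntegral.integral_add_adjacent_intervals (b := 0)
    (cont.intervalIntegrable _ _) (cont.intervalIntegrable _ _)]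
  have h2 : ∫ w in (0 : ℝ)..L, (|w| + τ)⁻¹ = Real.log (1 + L / τ) := by
    have : ∫ w in (0 : ℝ)..L, (|w| + τ)⁻¹ = ∫ w in (0 : ℝ)..L, (w + τ)⁻¹ := by
      refine intervalIntegral.integral_congr fun w hw => ?_
      rw [Set.uIcc_of_le hL.le] at hw
      simp only [abs_of_nonneg hw.1]
    rw [this, intervalIntegral.integral_comp_add_right (fun w => w⁻¹) τ, zero_add,
      integral_inv_of_pos hτ (by positivity)]
    congr 1; field_simp; ring
  have h3 : ∫ w in (-L)..0, (|w| + τ)⁻¹ = ∫ w in (0 : ℝ)..L, (|w| + τ)⁻¹ := by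
    have := intervalIntegral.integral_comp_neg (a := 0) (b := L) (fun w => (|w| + τ)⁻¹)
    simp only [abs_neg, neg_zero] at this
    exact this.symm
  rw [h3, h2]; ring

/-- logarithmic factor -/
noncomputable def Lg (R τ : ℝ) : ℝ := 1 + Real.log (1 + 16 * R ^ 2 / τ)

lemma Lg_ge {R τ : ℝ} (hτ : 0 < τ) : 1 ≤ Lg R τ := by
  unfold Lg
  have : 0 ≤ Real.log (1 + 16 * R ^ 2 / τ) := Real.log_nonneg (by
    have : 0 ≤ 16 * R ^ 2 / τ := by positivity
    linarith)
  linarith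

lemma mw_rho_int {R τ : ℝ} (hR : 1 ≤ R) (hτ : 0 < τ) (y : E3) :
    ∫ ρ in Set.Icc (R ^ 2) (4 * R ^ 2), mw R τ ρ y ≤ 50 * Lg R τ * R ^ 2 * (R + ‖y‖)⁻¹ := by
  have ny := norm_nonneg y
  have L1 := Lg_ge (R := R) hτ
  unfold mw
  rw [integral_const_mul]
  have pos : 0 < R + ‖y‖ := by linarith
  rw [le_mul_inv_iff₀ pos]
  rcases le_or_gt ‖y‖ (4 * R) with y4 | y4
  · have h1 := oned (s := ‖y‖ ^ 2) (L := 16 * R ^ 2) (A := R ^ 2) (B := 4 * R ^ 2) hτ (by positivity)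
      (by nlinarith) (by nlinarith)
    have h2 : Real.log (1 + 16 * R ^ 2 / τ) ≤ Lg R τ := by unfold Lg; linarith
    have h0 : 0 ≤ ∫ ρ in Set.Icc (R ^ 2) (4 * R ^ 2), (|‖y‖ ^ 2 - ρ| + τ)⁻¹ :=
      integral_nonneg fun ρ => by simp only [Pi.zero_apply]; positivity
    calc _ ≤ (4 * R + R) * (2 * Lg R τ) * (R + 4 * R) := by
          gcongr; linarith
      _ = _ := by ring
  · have h1 : ∫ ρ in Set.Icc (R ^ 2) (4 * R ^ 2), (|‖y‖ ^ 2 - ρ| + τ)⁻¹ ≤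
        ∫ ρ in Set.Icc (R ^ 2) (4 * R ^ 2), ((R + ‖y‖) ^ 2 / 10)⁻¹ := by
      refine setIntegral_mono_on ?_ ?_ measurableSet_Icc fun ρ hρ => ?_
      · refine Continuous.integrableOn_Icc (Continuous.inv₀ (by fun_prop) fun w => by positivity)
      · exact continuous_const.integrableOn_Icc
      · have := le_abs_self (‖y‖ ^ 2 - ρ)
        have := hρ.2
        gcongr
        nlinarith
    rw [setIntegral_const, measureReal_def, Real.volume_Icc, ENNReal.toReal_ofReal (by nlinarith), smul_eq_mul] at h1
    calc _ ≤ (‖y‖ + R) * ((4 * R ^ 2 - R ^ 2) * ((R + ‖y‖) ^ 2 / 10)⁻¹) * (R + ‖y‖) := by gcongr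
      _ = 30 * R ^ 2 := by field_simp; ring
      _ ≤ 50 * Lg R τ * R ^ 2 := by nlinarith [sq_nonneg R]

lemma mw_prod {R τ : ℝ} (hR : 1 ≤ R) (hτ : 0 < τ) (hτ1 : τ ≤ 1) {u f : E3 → ℝ} (hu : PP u f) :
    Integrable (fun z : ℝ × E3 => f z.2 * mw R τ z.1 z.2)
      ((volume.restrict (Set.Icc (R ^ 2) (4 * R ^ 2))).prod volume) := by
  have R0 : 0 < R := by linarith
  have hf := hu.hf
  have i1 : Integrable (fun _ : ℝ => (25 * R ^ 2 * τ⁻¹ + 10)) (volume.restrict (Set.Icc (R ^ 2) (4 * R ^ 2))) :=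
    continuous_const.integrableOn_Icc
  have i2 := i1.mul_prod (hu.A_integrable R0)
  refine i2.mono' ?_ ?_
  · refine Continuous.aestronglyMeasurable ?_
    unfold mw
    refine (hf.comp continuous_snd).mul (Continuous.mul (by fun_prop) (Continuous.inv₀ (by fun_prop) fun z => ?_))
    positivity
  · have hm : ∀ᵐ z ∂((volume.restrict (Set.Icc (R ^ 2) (4 * R ^ 2))).prod (volume : Measure E3)),
        z.1 ∈ Set.Icc (R ^ 2) (4 * R ^ 2) :=
      Measure.quasiMeasurePreserving_fst.ae (ae_restrict_mem measurableSet_Icc)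
    filter_upwards [hm] with z hz
    have h : Adm R τ z.1 := ⟨hR, hτ, hτ1, hz.1, hz.2⟩
    rw [Real.norm_eq_abs, abs_of_nonneg (mul_nonneg (hu.hf0 _) (h.mw_nonneg _))]
    calc f z.2 * mw R τ z.1 z.2 ≤ f z.2 * ((25 * R ^ 2 * τ⁻¹ + 10) * (R + ‖z.2‖)⁻¹) :=
        mul_le_mul_of_nonneg_left (h.mw_le _) (hu.hf0 _)
      _ = _ := by ring

lemma Psi_int {R τ : ℝ} (hR : 1 ≤ R) (hτ : 0 < τ) (hτ1 : τ ≤ 1) {u f : E3 → ℝ} (hu : PP u f) :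
    IntegrableOn (fun ρ => Psi f R τ ρ) (Set.Icc (R ^ 2) (4 * R ^ 2)) ∧
    ∫ ρ in Set.Icc (R ^ 2) (4 * R ^ 2), Psi f R τ ρ ≤ 50 * Lg R τ * R ^ 2 * A f R := by
  have R0 : 0 < R := by linarith
  have i := mw_prod hR hτ hτ1 hu
  refine ⟨i.integral_prod_left, ?_⟩
  have e : ∫ ρ in Set.Icc (R ^ 2) (4 * R ^ 2), Psi f R τ ρ =
      ∫ y, ∫ ρ in Set.Icc (R ^ 2) (4 * R ^ 2), f y * mw R τ ρ y := by
    unfold Psi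
    exact integral_integral_swap i
  have i2 : Integrable fun y => ∫ ρ in Set.Icc (R ^ 2) (4 * R ^ 2), f y * mw R τ ρ y := i.integral_prod_right
  rw [e, A, ← integral_const_mul]
  refine integral_mono i2 ((hu.A_integrable R0).const_mul _) fun y => ?_
  simp only
  rw [integral_const_mul]
  calc _ ≤ f y * (50 * Lg R τ * R ^ 2 * (R + ‖y‖)⁻¹) :=
        mul_le_mul_of_nonneg_left (mw_rho_int hR hτ y) (hu.hf0 y)
    _ = _ := by ring

lemma good_rho {R τ : ℝ} (hR : 1 ≤ R) (hτ : 0 < τ) (hτ1 : τ ≤ 1) {u f v g : E3 → ℝ} (hu : PP u f)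
    (hv : PP v g) (hAf : 0 < A f R) (hAg : 0 < A g R) :
    ∃ ρ, Adm R τ ρ ∧ Psi f R τ ρ ≤ 34 * Lg R τ * A f R ∧ Psi g R τ ρ ≤ 34 * Lg R τ * A g R := by
  obtain ⟨i1, b1⟩ := Psi_int hR hτ hτ1 hu
  obtain ⟨i2, b2⟩ := Psi_int hR hτ hτ1 hv
  have i3 : IntegrableOn (fun ρ => Psi f R τ ρ * (A f R)⁻¹ + Psi g R τ ρ * (A g R)⁻¹)
      (Set.Icc (R ^ 2) (4 * R ^ 2)) := (i1.mul_const _).add (i2.mul_const _)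
  have vol : volume (Set.Icc (R ^ 2) (4 * R ^ 2)) = ENNReal.ofReal (3 * R ^ 2) := by
    rw [Real.volume_Icc]; congr 1; ring
  obtain ⟨ρ, hρ, hle⟩ := exists_le_setAverage (by rw [vol]; simp; positivity) (by rw [vol]; exact ENNReal.ofReal_ne_top) i3
  have h : Adm R τ ρ := ⟨hR, hτ, hτ1, hρ.1, hρ.2⟩
  have L1 := Lg_ge (R := R) hτ
  have tot : Psi f R τ ρ * (A f R)⁻¹ + Psi g R τ ρ * (A g R)⁻¹ ≤ 34 * Lg R τ := by
    refine hle.trans ?_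
    rw [setAverage_eq, measureReal_def, vol, ENNReal.toReal_ofReal (by positivity),
      integral_add (i1.mul_const _) (i2.mul_const _), integral_mul_const, integral_mul_const, smul_eq_mul]
    have c1 : (∫ ρ in Set.Icc (R ^ 2) (4 * R ^ 2), Psi f R τ ρ) * (A f R)⁻¹ ≤ 50 * Lg R τ * R ^ 2 := by
      rw [mul_inv_le_iff₀ hAf]; exact b1
    have c2 : (∫ ρ in Set.Icc (R ^ 2) (4 * R ^ 2), Psi g R τ ρ) * (A g R)⁻¹ ≤ 50 * Lg R τ * R ^ 2 := by
      rw [mul_inv_le_iff₀ hAg]; exact b2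
    rw [inv_mul_le_iff₀ (by positivity)]
    nlinarith [mul_nonneg (zero_le_one.trans L1) (sq_nonneg R)]
  have p1 := mul_nonneg (Psi_nonneg h hu) (inv_nonneg.2 hAf.le)
  have p2 := mul_nonneg (Psi_nonneg h hv) (inv_nonneg.2 hAg.le)
  refine ⟨ρ, h, ?_, ?_⟩
  · rw [← mul_inv_le_iff₀ hAf]; linarith
  · rw [← mul_inv_le_iff₀ hAg]; linarith
end HLE

namespace HLE
open Filter Topology

lemma alg_core {c X Y W Z E Bg Bf p q a b : ℝ} (hc : 0 < c) (hp : 0 < p) (hq : 0 < q) (ha : 0 ≤ a)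
    (hE : 0 ≤ E)
    (h1 : -(c * W + c * Z) ≤ c * X + E) (h2 : c * X ≤ c * Y + E)
    (h3 : (q + 1) * W = -(3 + b) * X - Bg) (h4 : (p + 1) * Z = -(3 + a) * Y - Bf) :
    ((3 + a) / (p + 1) + (3 + b) / (q + 1) - 1) * (c * X) ≤
      (4 + a) * E + c * |Bg| + c * |Bf| := by
  have e3 : W = -((3 + b) / (q + 1)) * X - Bg / (q + 1) := by field_simp; linarith
  have e4 : Z = -((3 + a) / (p + 1)) * Y - Bf / (p + 1) := by field_simp; linarith
  have b1 : |Bg / (q + 1)| ≤ |Bg| := by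
    rw [abs_div, abs_of_pos (by linarith : 0 < q + 1)]
    exact div_le_self (abs_nonneg _) (by linarith)
  have b2 : |Bf / (p + 1)| ≤ |Bf| := by
    rw [abs_div, abs_of_pos (by linarith : 0 < p + 1)]
    exact div_le_self (abs_nonneg _) (by linarith)
  have b3 := neg_abs_le (Bg / (q + 1))
  have b4 := neg_abs_le (Bf / (p + 1))
  have d1 : (3 + a) / (p + 1) ≤ 3 + a := div_le_self (by linarith) (by linarith)
  have d0 : 0 ≤ (3 + a) / (p + 1) := by positivity
  subst e3 e4
  generalize (3 + a) / (p + 1) = B at *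
  generalize (3 + b) / (q + 1) = A at *
  generalize Bg / (q + 1) = s at *
  generalize Bf / (p + 1) = t at *
  have m1 := mul_le_mul_of_nonneg_left h2 d0
  have m2 := mul_le_mul_of_nonneg_right d1 hE
  have m3 : -(c * s) ≤ c * |Bg| := by nlinarith
  have m4 : -(c * t) ≤ c * |Bf| := by nlinarith
  nlinarith

lemma bound_core {R τ Lc N F F' L P Q x y Ma Mb H : ℝ} (hR : 1 ≤ R) (h0 : 0 < τ) (h1 : τ ≤ 1)
    (hL : 1 ≤ L) (hLc : 0 ≤ Lc) (hN : 0 ≤ N) (hF0 : 0 ≤ F) (hF0' : 0 ≤ F')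
    (hF : F * τ * R ≤ H * R⁻¹) (hF' : F' * τ * R ≤ H * R⁻¹) 
    (hx0 : 0 ≤ x) (hy0 : 0 ≤ y) (hx : x ≤ Ma) (hy : y ≤ Mb)
    (hP0 : 0 ≤ P) (hQ0 : 0 ≤ Q) (hP : P ≤ 34 * L * x) (hQ : Q ≤ 34 * L * y) :
    3000 * R * (Q * P) + 36 * Lc * R ^ 2 * τ⁻¹ * (F * ((τ / (8 * R)) ^ 2 * N) * (4 * R * y)) ≤
      (3000 * 34 ^ 2 + 3 * Lc * N * H * Mb) * (R * L ^ 2 * (x * y) + L * R⁻¹) ∧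
    8 * Lc * R * Q * (18 * P + F * ((τ / (8 * R)) ^ 2 * N)) ≤
      (144 * 34 ^ 2 * Lc + 8 * 34 * Lc * N * H * Mb) * (R * L ^ 2 * (x * y) + L * R⁻¹) ∧
    8 * Lc * R * P * (18 * Q + F' * ((τ / (8 * R)) ^ 2 * N)) ≤
      (144 * 34 ^ 2 * Lc + 8 * 34 * Lc * N * H * Ma) * (R * L ^ 2 * (x * y) + L * R⁻¹) := by
  have R0 : 0 < R := by linarith
  have Ri : 0 < R⁻¹ := by positivity
  have hH : 0 ≤ H := by
    have : 0 ≤ H * R⁻¹ := le_trans (by positivity) hF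
    exact nonneg_of_mul_nonneg_left this Ri
  have hMa : 0 ≤ Ma := hx0.trans hx
  have hMb : 0 ≤ Mb := hy0.trans hy
  have hPQ : Q * P ≤ 34 ^ 2 * L ^ 2 * (x * y) :=
    (mul_le_mul hQ hP hP0 (by positivity)).trans (le_of_eq (by ring))
  have t1 : 0 ≤ R * L ^ 2 * (x * y) := by positivity
  have t2 : 0 ≤ L * R⁻¹ := by positivity
  have small : ∀ G : ℝ, 0 ≤ G → G * τ * R ≤ H * R⁻¹ → R * (G * ((τ / (8 * R)) ^ 2 * N)) ≤ N * H * R⁻¹ := by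
    intro G hG hh
    have e : R * (G * ((τ / (8 * R)) ^ 2 * N)) = N * (G * τ * R * (τ / (64 * R ^ 2))) := by
      field_simp; ring
    have : τ / (64 * R ^ 2) ≤ 1 := by rw [div_le_one (by positivity)]; nlinarith
    rw [e, mul_assoc N]
    refine mul_le_mul_of_nonneg_left ?_ hN
    exact (mul_le_of_le_one_right (by positivity) this).trans hh
  have bd : ∀ G P Q x y M : ℝ, 0 ≤ G → 0 ≤ y → y ≤ M → G * τ * R ≤ H * R⁻¹ → 0 ≤ P → 0 ≤ Q → 
      Q ≤ 34 * L * y → Q * P ≤ 34 ^ 2 * L ^ 2 * (x * y) → 0 ≤ R * L ^ 2 * (x * y) →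
      8 * Lc * R * Q * (18 * P + G * ((τ / (8 * R)) ^ 2 * N)) ≤
      (144 * 34 ^ 2 * Lc + 8 * 34 * Lc * N * H * M) * (R * L ^ 2 * (x * y) + L * R⁻¹) := by
    intro G P Q x y M hG hy0 hy hh hP0 hQ0 hQ hPQ t1
    have hM : 0 ≤ M := hy0.trans hy
    have s := small G hG hh
    have e : 8 * Lc * R * Q * (18 * P + G * ((τ / (8 * R)) ^ 2 * N)) =
      144 * Lc * (R * (Q * P)) + 8 * Lc * (Q * (R * (G * ((τ / (8 * R)) ^ 2 * N)))) := by ring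
    rw [e]
    have u1 : 144 * Lc * (R * (Q * P)) ≤ 144 * Lc * (R * (34 ^ 2 * L ^ 2 * (x * y))) := by gcongr
    have hQM : Q ≤ 34 * L * M := hQ.trans (by gcongr)
    have u2 : 8 * Lc * (Q * (R * (G * ((τ / (8 * R)) ^ 2 * N)))) ≤ 8 * Lc * ((34 * L * M) * (N * H * R⁻¹)) := by
      gcongr
    have z1 : 0 ≤ 144 * 34 ^ 2 * Lc * (L * R⁻¹) := by positivity
    have z2 : 0 ≤ 8 * 34 * Lc * N * H * M * (R * L ^ 2 * (x * y)) := by positivity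
    linarith
  refine ⟨?_, bd F P Q x y Mb hF0 hy0 hy hF hP0 hQ0 hQ hPQ t1, ?_⟩
  · have e : 36 * Lc * R ^ 2 * τ⁻¹ * (F * ((τ / (8 * R)) ^ 2 * N) * (4 * R * y)) =
        9 / 4 * Lc * N * (F * τ * R) * y := by field_simp; ring
    rw [e]
    have u1 : 3000 * R * (Q * P) ≤ 3000 * R * (34 ^ 2 * L ^ 2 * (x * y)) := by gcongr
    have u2 : 9 / 4 * Lc * N * (F * τ * R) * y ≤ 3 * Lc * N * (H * R⁻¹) * Mb := by
      gcongr; norm_num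
    have u3 : 3 * Lc * N * H * Mb * R⁻¹ ≤ 3 * Lc * N * H * Mb * (L * R⁻¹) := by
      gcongr; nlinarith
    have z2 : 0 ≤ 3 * Lc * N * H * Mb * (R * L ^ 2 * (x * y)) := by positivity
    linarith
  · have := bd F' Q P y x Ma hF0' hx0 hx hF' hQ0 hP0 hP (by linarith) (by linarith)
    rw [mul_comm y x] at this
    exact this

set_option maxHeartbeats 1600000 in
lemma final {u f v g : E3 → ℝ} (hu : PP u f) (hv : PP v g) {p q a b : ℝ} (hp : 0 < p) (hq : 0 < q)
    (ha : 0 ≤ a) (hb : 0 ≤ b) (hpq : 1 < p * q)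
    (hhyp : 1 < (3 + a) / (p + 1) + (3 + b) / (q + 1))
    (hf : ∀ x, f x = ‖x‖ ^ a * v x ^ p) (hg : ∀ x, g x = ‖x‖ ^ b * u x ^ q) : False := by
  have Vu : Van u := vanishing hu hv hq hb hg
  have Vv : Van v := vanishing hv hu hp ha hf
  obtain ⟨Mu, hMu⟩ := hu.bdd
  obtain ⟨Mv, hMv⟩ := hv.bdd
  have Mu0 : 0 < Mu := (hu.pos 0).trans_le (hMu 0)
  have Mv0 : 0 < Mv := (hv.pos 0).trans_le (hMv 0)
  obtain ⟨C1, C10, hC1⟩ := A_decay hu hv hp hq ha hb hpq hf hg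
  obtain ⟨C2, C20, hC2⟩ := A_decay hv hu hq hp hb ha (by linarith) hg hf
  obtain ⟨Lc, Lc0, hLd, hLl⟩ := exists_Lc
  set α := (2 + a + p * (2 + b)) / (p * q - 1) with hα
  set β := (2 + b + q * (2 + a)) / (q * p - 1) with hβ
  have hδ : 0 < α + β - 1 := by
    have e : α + β - 1 = (5 + a + b + 2 * p + 2 * q + p * b + q * a - p * q) / (p * q - 1) := by
      rw [hα, hβ, mul_comm q p]
      have : p * q - 1 ≠ 0 := by linarith
      field_simp; ring
    rw [e]
    refine div_pos ?_ (by linarith)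
    rw [div_add_div _ _ (by positivity) (by positivity), lt_div_iff₀ (by positivity)] at hhyp
    nlinarith
  set e : E3 := EuclideanSpace.single 0 1 with he
  have ne : ‖e‖ = 1 := by simp [he]
  have fe : f e ≠ 0 := by
    rw [hf, ne, Real.one_rpow, one_mul]; exact (Real.rpow_pos_of_pos (hv.pos _) _).ne'
  have ge : g e ≠ 0 := by
    rw [hg, ne, Real.one_rpow, one_mul]; exact (Real.rpow_pos_of_pos (hu.pos _) _).ne'
  have cφ : ∀ ρ τ, Continuous (phi ρ τ) := fun ρ τ => (contDiff_phi ρ τ).continuous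
  have cu := hu.hu.continuous
  have cg := hv.hf
  have c1 : ∀ ρ τ, Continuous fun x => phi ρ τ x * g x * u x := fun ρ τ => ((cφ ρ τ).mul cg).mul cu
  have s1 : ∀ ρ τ, 0 < τ → HasCompactSupport fun x => phi ρ τ x * g x * u x :=
    fun ρ τ h => ((phi_cs h).mul_right).mul_right
  set X0 := ∫ x, phi 2 1 x * g x * u x with hX0
  have X0pos : 0 < X0 := by
    refine (c1 2 1).integral_pos_of_hasCompactSupport_nonneg_nonzero (s1 2 1 one_pos) (x := e) ?_ ?_
    · exact fun x => mul_nonneg (mul_nonneg (phi_nonneg _ _ _) (hv.hf0 x)) (hu.pos x).le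
    · rw [phi_one one_pos (by rw [ne]; norm_num), one_mul]
      exact mul_ne_zero ge (hu.pos _).ne'
  set κ := a + b + 2 with hκ
  set H := Mv ^ p * 3 ^ a + Mu ^ q * 3 ^ b with hH
  have hH1 : 0 < Mv ^ p * 3 ^ a := by positivity
  have hH2 : 0 < Mu ^ q * 3 ^ b := by positivity
  set γ := (3 + a) / (p + 1) + (3 + b) / (q + 1) - 1 with hγ
  have γ0 : 0 < γ := by linarith
  set Ma := c0 * u 0
  set Mb := c0 * v 0
  set K1 := 3000 * 34 ^ 2 + 3 * Lc * N1 * H * Mb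
  set K2 := 144 * 34 ^ 2 * Lc + 8 * 34 * Lc * N1 * H * Mb
  set K3 := 144 * 34 ^ 2 * Lc + 8 * 34 * Lc * N1 * H * Ma
  set K := (4 + a) * K1 + K2 + K3
  have key : ∀ R : ℝ, 2 ≤ R → γ * (c0 * X0) ≤
      K * (R * Lg R (R ^ (-κ)) ^ 2 * (A f R * A g R) + Lg R (R ^ (-κ)) * R⁻¹) := by
    intro R hR2
    have R0 : 0 < R := by linarith
    have R1 : 1 ≤ R := by linarith
    set τ := R ^ (-κ) with hτ
    have τ0 : 0 < τ := Real.rpow_pos_of_pos R0 _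
    have τ1 : τ ≤ 1 := Real.rpow_le_one_of_one_le_of_nonpos R1 (by rw [hκ]; linarith)
    obtain ⟨ρ, adm, pf, pg⟩ := good_rho R1 τ0 τ1 hu hv (hu.A_pos R0 fe) (hv.A_pos R0 ge)
    have hFg : ∀ {M c s : ℝ} {w h : E3 → ℝ}, (∀ x, 0 < w x) → (∀ x, w x ≤ M) → 0 ≤ c → 0 ≤ s →
        (∀ x, h x = ‖x‖ ^ s * w x ^ c) →
        ∀ y ∈ Metric.closedBall (0 : E3) (3 * R), h y ≤ M ^ c * (3 * R) ^ s := by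
      intro M c s w h hw hM hc hs hh y hy
      rw [mem_closedBall_zero_iff] at hy
      rw [hh, mul_comm]
      have := (hw y).le
      have := hM y
      have : 0 ≤ M := by linarith
      have : 0 ≤ M ^ c := Real.rpow_nonneg this _
      gcongr
    have hF := hFg hv.pos hMv hp.le ha hf
    have hF' := hFg hu.pos hMu hq.le hb hg
    have hsm : ∀ {M s : ℝ}, 0 ≤ M → s ≤ a + b → M * 3 ^ s ≤ H → M * (3 * R) ^ s * τ * R ≤ H * R⁻¹ := by
      intro M s hM hs hMH
      rw [Real.mul_rpow (by norm_num) R0.le]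
      have e1 : M * (3 ^ s * R ^ s) * τ * R = M * 3 ^ s * (R ^ (s - κ + 1)) := by
        rw [Real.rpow_add R0, Real.rpow_sub R0, hτ, Real.rpow_neg R0.le, Real.rpow_one]; ring
      rw [e1, ← Real.rpow_neg_one]
      have : R ^ (s - κ + 1) ≤ R ^ (-1 : ℝ) := Real.rpow_le_rpow_of_exponent_le R1 (by rw [hκ]; linarith)
      have : 0 ≤ M * 3 ^ s := by positivity
      gcongr
    have F0 : 0 ≤ Mv ^ p * (3 * R) ^ a := by positivity
    have F0' : 0 ≤ Mu ^ q * (3 * R) ^ b := by positivity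
    obtain ⟨bE, bG, bF⟩ := bound_core (N := N1) R1 τ0 τ1 (Lg_ge τ0) Lc0.le N1_nonneg F0 F0'
      (hsm (by positivity) (by linarith) (by linarith : Mv ^ p * 3 ^ a ≤ H))
      (hsm (by positivity) (by linarith) (by linarith : Mu ^ q * 3 ^ b ≤ H))
      (hu.A_pos R0 fe).le (hv.A_pos R0 ge).le
      (hu.A_le R0 (x := 0) (by simpa using R0.le)) (hv.A_le R0 (x := 0) (by simpa using R0.le))
      (Psi_nonneg adm hu) (Psi_nonneg adm hv) pf pg
    obtain ⟨iE, lE⟩ := E_bd hu hv adm Lc0.le hLl F0 hF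
    have lG := bdry hu hv Vu adm hLd hF F0
    have lF := bdry hv hu Vv adm hLd hF' F0'
    have P1 := poh1 hu hv Vu Vv (cφ ρ τ) (phi_cs τ0) (phi_nonneg ρ τ) iE
    have P2 := poh2 hu hv Vu Vv (cφ ρ τ) (phi_cs τ0) iE
    have D1 := dil2 hu hq hb (contDiff_phi ρ τ) (phi_cs τ0) hg
    have D2 := dil2 hv hp ha (contDiff_phi ρ τ) (phi_cs τ0) hf
    have E0 : 0 ≤ ∫ z : E3 × E3, g z.1 * f z.2 * Kn (phi ρ τ) z.1 z.2 ∂(volume.prod volume) :=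
      integral_nonneg fun z => mul_nonneg (mul_nonneg (hv.hf0 _) (hu.hf0 _)) (Kn_nonneg _ _ _)
    have main := alg_core c0_pos hp hq ha E0 P1 P2 D1 D2
    have hρ4 : 4 ≤ ρ := le_trans (by nlinarith only [hR2]) adm.r0
    have XX : X0 ≤ ∫ x, phi ρ τ x * g x * u x := by
      refine integral_mono ((c1 _ _).integrable_of_hasCompactSupport (s1 _ _ one_pos))
        ((c1 _ _).integrable_of_hasCompactSupport (s1 _ _ τ0)) fun x => ?_
      have hh : phi 2 1 x ≤ phi ρ τ x := by
        rcases le_total (‖x‖ ^ 2) 2 with h | h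
        · rw [phi_one τ0 (x := x) (by linarith)]; exact phi_le_one _ _ _
        · rw [phi_zero one_pos h]; exact phi_nonneg _ _ _
      have := hv.hf0 x
      have := (hu.pos x).le
      dsimp only
      gcongr
    have c0p := c0_pos
    have l1 : γ * (c0 * X0) ≤ γ * (c0 * ∫ x, phi ρ τ x * g x * u x) := by gcongr
    have l2 := mul_le_mul_of_nonneg_left (lE.trans bE) (by linarith : 0 ≤ 4 + a)
    have l3 := lG.trans bG
    have l4 := lF.trans bF
    refine l1.trans (main.trans ?_)
    calc _ ≤ _ := add_le_add (add_le_add l2 l3) l4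
      _ = _ := by ring
  set η := min (α + β - 1) 1 / 4 with hη
  have η0 : 0 < η := by positivity
  have ηa : 4 * η ≤ α + β - 1 := by rw [hη]; linarith [min_le_left (α + β - 1) 1]
  have ηb : 4 * η ≤ 1 := by rw [hη]; linarith [min_le_right (α + β - 1) 1]
  set CL := 1 + Real.log 17 + (2 + κ) / η with hCL
  have CL0 : 0 ≤ CL := by
    have : 0 ≤ Real.log 17 := Real.log_nonneg (by norm_num)
    positivity
  have hLg : ∀ R : ℝ, 2 ≤ R → Lg R (R ^ (-κ)) ≤ CL * R ^ η := by
    intro R hR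
    have R0 : 0 < R := by linarith
    have R1 : 1 ≤ R := by linarith
    have e1 : 1 + 16 * R ^ 2 / R ^ (-κ) ≤ 17 * R ^ (2 + κ) := by
      rw [Real.rpow_add R0, Real.rpow_neg R0.le, div_inv_eq_mul, Real.rpow_two]
      have : 1 ≤ R ^ κ := Real.one_le_rpow R1 (by rw [hκ]; linarith)
      nlinarith [mul_le_mul (by nlinarith : (1 : ℝ) ≤ R ^ 2) this zero_le_one (by positivity)]
    have e2 : Real.log (1 + 16 * R ^ 2 / R ^ (-κ)) ≤ Real.log 17 + (2 + κ) * Real.log R := by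
      rw [← Real.log_rpow R0, ← Real.log_mul (by norm_num) (by positivity)]
      exact Real.log_le_log (by positivity) e1
    have e3 := Real.log_le_rpow_div R0.le η0
    have e4 : 1 ≤ R ^ η := Real.one_le_rpow R1 η0.le
    have : 0 ≤ Real.log 17 := Real.log_nonneg (by norm_num)
    have k0 : 0 ≤ 2 + κ := by rw [hκ]; linarith
    have e5 : (2 + κ) * Real.log R ≤ (2 + κ) / η * R ^ η := 
      (mul_le_mul_of_nonneg_left e3 k0).trans (le_of_eq (by ring))
    unfold Lg
    rw [hCL]
    nlinarith
  have K0 : 0 ≤ K := by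
    have := c0_pos; have := N1_nonneg; have := hu.pos 0; have := hv.pos 0
    positivity
  have key2 : ∀ R : ℝ, 2 ≤ R → γ * (c0 * X0) ≤ K * (CL ^ 2 * C1 * C2 + CL) * R ^ (-η) := by
    intro R hR
    have R0 : 0 < R := by linarith
    have R1 : 1 ≤ R := by linarith
    refine (key R hR).trans ?_
    rw [mul_assoc K (CL ^ 2 * C1 * C2 + CL)]
    refine mul_le_mul_of_nonneg_left ?_ K0
    have L1 := hLg R hR
    have L0 : 0 ≤ Lg R (R ^ (-κ)) := by linarith [Lg_ge (R := R) (Real.rpow_pos_of_pos R0 (-κ))]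
    have f0 := (hu.A_pos R0 fe).le
    have g0 := (hv.A_pos R0 ge).le
    have t1 : R * Lg R (R ^ (-κ)) ^ 2 * (A f R * A g R) ≤ CL ^ 2 * C1 * C2 * R ^ (-η) := by
      calc _ ≤ R * (CL * R ^ η) ^ 2 * ((C1 * R ^ (-α)) * (C2 * R ^ (-β))) := by
            gcongr
            · exact hC1 R R0
            · exact hC2 R R0
        _ = CL ^ 2 * C1 * C2 * R ^ (1 + (η + η) + (-α + -β)) := by
            rw [Real.rpow_add R0, Real.rpow_add R0, Real.rpow_add R0, Real.rpow_add R0, Real.rpow_one]; ring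
        _ ≤ _ := by
            gcongr
            · linarith
    have t2 : Lg R (R ^ (-κ)) * R⁻¹ ≤ CL * R ^ (-η) := by
      calc _ ≤ CL * R ^ η * R⁻¹ := by gcongr
        _ = CL * R ^ (η + -1) := by rw [Real.rpow_add R0, Real.rpow_neg_one]; ring
        _ ≤ _ := by
            gcongr
            · linarith
    linarith
  have lim : Tendsto (fun R : ℝ => K * (CL ^ 2 * C1 * C2 + CL) * R ^ (-η)) atTop (𝓝 0) := by
    simpa using (tendsto_rpow_neg_atTop η0).const_mul (K * (CL ^ 2 * C1 * C2 + CL))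
  have hpos : 0 < γ * (c0 * X0) := mul_pos γ0 (mul_pos c0_pos X0pos)
  have := ge_of_tendsto lim ((eventually_ge_atTop 2).mono key2)
  linarith

end HLE

/-- **Hénon–Lane–Emden, dimension 3, bounded solutions.**
If `p, q, a, b ≥ 0`, `pq > 1` and `(p, q)` lies under the critical Sobolev hyperbola
`(N+a)/(p+1) + (N+b)/(q+1) > N-2` with `N = 3`, then the Hénon–Lane–Emden system
`-Δu = |x|^a v^p`, `-Δv = |x|^b u^q` on `ℝ³` has no positive bounded solution. -/
theorem henon_lane_emden_dim3_no_bounded_positive_solution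
    (p q a b : ℝ) (hp : 0 ≤ p) (hq : 0 ≤ q) (ha : 0 ≤ a) (hb : 0 ≤ b)
    (hpq : 1 < p * q)
    (hhyp : ((3 : ℝ) + a) / (p + 1) + ((3 : ℝ) + b) / (q + 1) > (3 : ℝ) - 2) :
    ¬ ∃ u v : EuclideanSpace ℝ (Fin 3) → ℝ,
        ContDiff ℝ 2 u ∧ ContDiff ℝ 2 v ∧
        (∀ x, 0 < u x) ∧ (∀ x, 0 < v x) ∧
        (∃ M : ℝ, ∀ x, u x ≤ M) ∧ (∃ M : ℝ, ∀ x, v x ≤ M) ∧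
        (∀ x, -lap u x = ‖x‖ ^ a * v x ^ p) ∧
        (∀ x, -lap v x = ‖x‖ ^ b * u x ^ q) := by
  rintro ⟨u, v, hu, hv, pu, pv, bu, bv, eu, ev⟩
  have p0 : 0 < p := hp.lt_of_ne (by rintro rfl; norm_num at hpq)
  have q0 : 0 < q := hq.lt_of_ne (by rintro rfl; norm_num at hpq)
  have cn : ∀ {s c : ℝ} {w : EuclideanSpace ℝ (Fin 3) → ℝ}, 0 ≤ s → 0 ≤ c → Continuous w →
      Continuous fun x => ‖x‖ ^ s * w x ^ c := fun hs hc hw =>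
    (continuous_norm.rpow_const fun _ => Or.inr hs).mul (hw.rpow_const fun _ => Or.inr hc)
  have n0 : ∀ {s c : ℝ} {w : EuclideanSpace ℝ (Fin 3) → ℝ}, (∀ x, 0 < w x) →
      ∀ x, 0 ≤ ‖x‖ ^ s * w x ^ c := fun hw x =>
    mul_nonneg (Real.rpow_nonneg (norm_nonneg _) _) (Real.rpow_nonneg (hw x).le _)
  exact HLE.final (f := fun x => ‖x‖ ^ a * v x ^ p) (g := fun x => ‖x‖ ^ b * u x ^ q)
    ⟨hu, pu, bu, cn ha hp hv.continuous, n0 pv, eu⟩ ⟨hv, pv, bv, cn hb hq hu.continuous, n0 pu, ev⟩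
    p0 q0 ha hb hpq (by norm_num at hhyp ⊢; linarith) (fun _ => rfl) (fun _ => rfl)
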